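/- For every n ≥ 8, the online size Ramsey number satisfies r̃(C4, Pn) ≤ 2n − 2; that is, Builder has a strategy which, against every Painter strategy, guarantees that after at most 2n − 2 rounds the graph of red edges contains a copy of the cycle C4 or the graph of blue edges contains a copy of the path Pn on n vertices. -/

import Mathlib

/-!
The online size Ramsey game on `K_ℕ`: in each round Builder selects a previously
unselected edge and Painter colours it red (`true`) or blue (`false`).
-/

namespace OnlineRamsey

abbrev Edge := Sym2 ℕ
abbrev History := List (Edge × Bool)   -- `true` = red, `false` = blue
abbrev BuilderStrat := History → Edge
abbrev PainterStrat := History → Edge → Bool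

/-- The history of the game after `t` rounds, when Builder follows `B` and
Painter follows `P`. -/
def gamePlay (B : BuilderStrat) (P : PainterStrat) : ℕ → History
  | 0 => []
  | t + 1 =>
      let h := gamePlay B P t
      h ++ [(B h, P h (B h))]

def redSet (h : History) : Set Edge := {e | (e, true) ∈ h}
def blueSet (h : History) : Set Edge := {e | (e, false) ∈ h}
def chosenSet (h : History) : Set Edge := {e | ∃ c, (e, c) ∈ h}

def redGraph (h : History) : SimpleGraph ℕ := SimpleGraph.fromEdgeSet (redSet h)
def blueGraph (h : History) : SimpleGraph ℕ := SimpleGraph.fromEdgeSet (blueSet h)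

/-- `H` contains a copy of `G`. -/
def HasCopy {α β : Type} (G : SimpleGraph α) (H : SimpleGraph β) : Prop :=
  ∃ f : G →g H, Function.Injective f

/-- During the first `m` rounds Builder always selects a previously unselected
(non-loop) edge, whatever Painter does. -/
def BuilderLegal (B : BuilderStrat) (m : ℕ) : Prop :=
  ∀ P : PainterStrat, ∀ t < m,
    ¬ (B (gamePlay B P t)).IsDiag ∧ B (gamePlay B P t) ∉ chosenSet (gamePlay B P t)

/-- Builder can force, within `m` rounds, the red graph to contain a copy of `G`
or the blue graph to contain a copy of `H`. -/
def BuilderForces {α β : Type} (G : SimpleGraph α) (H : SimpleGraph β) (m : ℕ) : Prop :=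
  ∃ B : BuilderStrat, BuilderLegal B m ∧
    ∀ P : PainterStrat, ∃ t ≤ m,
      HasCopy G (redGraph (gamePlay B P t)) ∨ HasCopy H (blueGraph (gamePlay B P t))

/-! ### The abstract game -/

/-- `h` contains a red edge between `u` and `v`. -/
def Rd (h : History) (u v : ℕ) : Prop := (s(u, v), true) ∈ h

/-- `h` contains a blue edge between `u` and `v`. -/
def Bl (h : History) (u v : ℕ) : Prop := (s(u, v), false) ∈ h

theorem Rd.symm {h : History} {u v : ℕ} (H : Rd h u v) : Rd h v u := by
  unfold Rd at *; rwa [Sym2.eq_swap]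

theorem Bl.symm {h : History} {u v : ℕ} (H : Bl h u v) : Bl h v u := by
  unfold Bl at *; rwa [Sym2.eq_swap]

/-- Builder has already reached the target. -/
def Won (n : ℕ) (h : History) : Prop :=
  HasCopy (SimpleGraph.cycleGraph 4) (redGraph h) ∨
    HasCopy (SimpleGraph.pathGraph n) (blueGraph h)

/-- Builder can reach the target from `h` with at most `e` further rounds. -/
def Win (n : ℕ) : ℕ → History → Prop
  | 0, h => Won n h
  | e + 1, h => Won n h ∨ ∃ u v : ℕ, u ≠ v ∧ s(u, v) ∉ chosenSet h ∧
      ∀ c, Win n e (h ++ [(s(u, v), c)])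

theorem Win.of_won {n : ℕ} {h : History} (H : Won n h) : ∀ e, Win n e h
  | 0 => H
  | _ + 1 => Or.inl H

theorem Win.succ {n : ℕ} : ∀ {e : ℕ} {h : History}, Win n e h → Win n (e + 1) h
  | 0, _, H => Or.inl H
  | _ + 1, _, H => by
    rcases H with H | ⟨u, v, huv, hc, H⟩
    · exact Or.inl H
    · exact Or.inr ⟨u, v, huv, hc, fun c => (H c).succ⟩

theorem Win.mono {n : ℕ} {h : History} {e e' : ℕ} (H : Win n e h) (hee : e ≤ e') :
    Win n e' h := by
  induction hee with
  | refl => exact H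
  | step _ ih => exact ih.succ

/-- Builder plays the edge `uv`; if it was played earlier, its colour is known for free. -/
theorem Win.play {n e : ℕ} {h : History} {u v : ℕ} (huv : u ≠ v)
    (H : ∀ h' : History, h ⊆ h' → ∀ c, (s(u, v), c) ∈ h' → Win n e h') : Win n (e + 1) h := by
  by_cases hc : s(u, v) ∈ chosenSet h
  · obtain ⟨c, hc⟩ := hc
    exact (H h (List.Subset.refl h) c hc).succ
  · refine Or.inr ⟨u, v, huv, hc, fun c => H _ ?_ c ?_⟩
    · exact List.subset_append_left _ _
    · simp

theorem won_of_c4 {n : ℕ} {h : History} {a b c d : ℕ} (hab : a ≠ b) (hac : a ≠ c) (had : a ≠ d)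
    (hbc : b ≠ c) (hbd : b ≠ d) (hcd : c ≠ d)
    (h1 : Rd h a b) (h2 : Rd h b c) (h3 : Rd h c d) (h4 : Rd h d a) : Won n h := by
  left
  have key : ∀ i j : Fin 4, (SimpleGraph.cycleGraph 4).Adj i j →
      (redGraph h).Adj (![a, b, c, d] i) (![a, b, c, d] j) := by
    intro i j hij
    have h1' := h1.symm
    have h2' := h2.symm
    have h3' := h3.symm
    have h4' := h4.symm
    unfold Rd at *
    rw [redGraph, SimpleGraph.fromEdgeSet_adj]
    fin_cases i <;> fin_cases j <;>
      first
        | exact absurd hij (by decide)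
        | (refine ⟨?_, ?_⟩ <;> first | assumption | (apply Ne.symm; assumption))
  refine ⟨⟨![a, b, c, d], fun {i j} hij => key i j hij⟩, ?_⟩
  intro i j hij
  change (![a, b, c, d] : Fin 4 → ℕ) i = ![a, b, c, d] j at hij
  fin_cases i <;> fin_cases j <;> simp_all

/-- Builder plays an edge which Painter has to colour blue. -/
theorem Win.forced {n e : ℕ} {h : History} {x p q y : ℕ} (hxp : x ≠ p) (hxq : x ≠ q) (hxy : x ≠ y)
    (hpq : p ≠ q) (hpy : p ≠ y) (hqy : q ≠ y)
    (h1 : Rd h x p) (h2 : Rd h p q) (h3 : Rd h q y)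
    (H : ∀ h' : History, h ⊆ h' → Bl h' x y → Win n e h') : Win n (e + 1) h := by
  refine Win.play hxy fun h' hh c hc => ?_
  cases c
  · exact H h' hh hc
  · exact Win.of_won (won_of_c4 hxp hxq hxy hpq hpy hqy (hh h1) (hh h2) (hh h3) (Rd.symm hc)) e

/-- `l` is a blue path. -/
def BP (h : History) (l : List ℕ) : Prop := l.Nodup ∧ l.IsChain (Bl h)

theorem BP.mono {h h' : History} {l : List ℕ} (hh : h ⊆ h') (H : BP h l) : BP h' l :=
  ⟨H.1, H.2.imp fun _ _ hab => hh hab⟩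

theorem BP.reverse {h : History} {l : List ℕ} (H : BP h l) : BP h l.reverse := by
  refine ⟨List.nodup_reverse.2 H.1, ?_⟩
  rw [List.isChain_reverse]
  exact H.2.imp fun _ _ hab => hab.symm

theorem won_of_path {n : ℕ} {h : History} {l : List ℕ} (H : BP h l) (hl : n ≤ l.length) :
    Won n h := by
  right
  have key : ∀ (i : ℕ) (hi : i + 1 < l.length), Bl h l[i] l[i + 1] := fun i hi =>
    List.isChain_iff_getElem.1 H.2 i hi
  have hinj : ∀ (i j : ℕ) (hi : i < l.length) (hj : j < l.length), l[i] = l[j] → i = j :=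
    fun i j hi hj hij => (H.1.getElem_inj_iff).1 hij
  refine ⟨⟨fun i => l[(i : ℕ)]'(by omega), ?_⟩, ?_⟩
  · intro i j hij
    rw [SimpleGraph.pathGraph_adj] at hij
    rw [blueGraph, SimpleGraph.fromEdgeSet_adj]
    constructor
    · rcases hij with hij | hij
      · have := key i (by omega)
        simp only [hij] at this
        exact this
      · have := key j (by omega)
        simp only [hij] at this
        exact this.symm
    · intro hc
      have := hinj _ _ _ _ hc
      omega
  · intro i j hij
    exact Fin.ext (hinj _ _ _ _ hij)

/-! ### From the abstract game to Builder strategies -/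

theorem exists_fresh (h : History) : ∃ e : Edge, ¬ e.IsDiag ∧ e ∉ chosenSet h := by
  have hfin : (chosenSet h).Finite := by
    refine ((h.map Prod.fst).finite_toSet).subset ?_
    rintro e ⟨c, hc⟩
    exact List.mem_map.2 ⟨_, hc, rfl⟩
  have hinj : Function.Injective fun k : ℕ => (s(0, k + 1) : Edge) := by
    intro a b hab
    simpa using hab
  obtain ⟨e, ⟨k, rfl⟩, he⟩ := (Set.infinite_range_of_injective hinj).exists_notMem_finite hfin
  exact ⟨_, by simp, he⟩

open Classical in
/-- Builder's strategy extracted from `Win`. -/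
noncomputable def strat (n m : ℕ) (h : History) : Edge :=
  if H : ∃ e : Edge, ¬ e.IsDiag ∧ e ∉ chosenSet h ∧
      ∀ c, Win n (m - (h.length + 1)) (h ++ [(e, c)]) then H.choose
  else (exists_fresh h).choose

theorem strat_legal (n m : ℕ) (h : History) :
    ¬ (strat n m h).IsDiag ∧ strat n m h ∉ chosenSet h := by
  unfold strat
  split_ifs with H
  · exact ⟨H.choose_spec.1, H.choose_spec.2.1⟩
  · exact (exists_fresh h).choose_spec

theorem gamePlay_length (B : BuilderStrat) (P : PainterStrat) (t : ℕ) :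
    (gamePlay B P t).length = t := by
  induction t with
  | zero => rfl
  | succ t ih => simp [gamePlay, ih]

theorem forces_of_win {n m : ℕ} (H : Win n m []) :
    BuilderForces (SimpleGraph.cycleGraph 4) (SimpleGraph.pathGraph n) m := by
  refine ⟨strat n m, fun P t _ => strat_legal n m _, fun P => ?_⟩
  have key : ∀ t ≤ m, (∃ t' ≤ t, Won n (gamePlay (strat n m) P t')) ∨
      Win n (m - t) (gamePlay (strat n m) P t) := by
    intro t
    induction t with
    | zero => exact fun _ => Or.inr H
    | succ t ih =>
      intro ht
      rcases ih (by omega) with ⟨t', ht', hw⟩ | hw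
      · exact Or.inl ⟨t', by omega, hw⟩
      · have hk : m - t = (m - (t + 1)) + 1 := by omega
        rw [hk] at hw
        rcases hw with hw | ⟨u, v, huv, hc, hw⟩
        · exact Or.inl ⟨t, by omega, hw⟩
        · right
          set h := gamePlay (strat n m) P t with hh
          have hlen : m - (h.length + 1) = m - (t + 1) := by rw [hh, gamePlay_length]
          have hex : ∃ e : Edge, ¬ e.IsDiag ∧ e ∉ chosenSet h ∧
              ∀ c, Win n (m - (h.length + 1)) (h ++ [(e, c)]) :=
            ⟨s(u, v), by simpa using huv, hc, by rw [hlen]; exact hw⟩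
          have hs : strat n m h = hex.choose := by unfold strat; rw [dif_pos hex]
          have := hex.choose_spec.2.2 (P h (strat n m h))
          rw [← hs] at this
          rw [hlen] at this
          exact this
  rcases key m le_rfl with ⟨t', ht', hw⟩ | hw
  · exact ⟨t', ht', hw⟩
  · rw [Nat.sub_self] at hw
    exact ⟨m, le_rfl, hw⟩

/-! ### Certificates

A certificate is a decision tree for Builder.  Named vertices are natural numbers; the current
long blue path has the named vertices `0` and `1` as its ends.
* `.p i j t₁ t₂`: play the edge `ij`, continue with `t₁` if it is red and with `t₂` if it is blue;
* `.l q sw xs ys g`: lengthen the path through `xs` at one end and `ys` at the other one, along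
  blue edges and edges which are forced to be blue; the result contains the pattern number `q`;
* `.d xs ys`: lengthen the path in the same way and obtain a path on `n` vertices. -/

inductive Tree where
  | p (i j : ℕ) (t₁ t₂ : Tree) : Tree
  | l (q : ℕ) (sw : Bool) (xs ys g : List ℕ) : Tree
  | d (xs ys : List ℕ) : Tree

/-- A pattern: a blue path with ends `0`, `1` together with red edges `red` on the named vertices
`0, …, sz - 1`, those from `2` on being outside of the path unless they belong to `inn`.  The claim
is that Builder wins in `2 * r + cc - 2` moves if `r ≥ rmin` vertices are missing from the path;
`base` and `sym` are the certificates of this claim. -/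
structure Pat where
  red : List (ℕ × ℕ)
  inn : List ℕ
  sz : ℕ
  cc : ℕ
  rmin : ℕ
  base : List Tree
  sym : Tree

def treeV1 : Tree :=
    .p 0 3 (.d [] [3]) (.d [3] [])

def treeV2 : Tree :=
    .p 0 3 (.p 1 4 (.d [4] [3]) (.p 2 4 (.d [] [4,3]) (.d [] [4,2]))) (.l 2 true [3] [] [2])

def treeVGe3 : Tree :=
    .p 0 3 (.l 5 false [] [3] [2]) (.l 2 true [3] [] [2])

def treeK1 : Tree :=
    .p 0 3 (.d [] [3]) (.d [3] [])

def treeK2 : Tree :=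
    .p 0 3 (.p 1 4 (.d [4] [3]) (.l 2 false [] [4] [3])) (.l 3 false [3] [] [])

def treeKGe3 : Tree :=
    .p 0 3 (.l 7 false [] [3] [2]) (.l 3 false [3] [] [])

def treeH1 : Tree :=
    .p 1 2 (.l 0 false [] [] [2]) (.d [] [2])

def treeHGe2 : Tree :=
    .p 1 2 (.l 0 false [] [] [2]) (.l 3 false [] [2] [])

def treeP1 : Tree :=
    .p 0 2 (.l 2 false [] [] [2]) (.d [2] [])

def treePGe2 : Tree :=
    .p 0 2 (.l 2 false [] [] [2]) (.l 3 false [2] [] [])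

def treeU13 : Tree :=
    .p 0 3 (.p 0 4 (.d [] [3,4,2]) (.p 3 5 (.d [4] [5,2]) (.d [4] [3,5]))) (.l 0 false [3] [] [2])

def treeU1Ge4 : Tree :=
    .p 0 4 (.l 0 false [] [4,3] [2]) (.l 6 true [4] [] [2,3])

def treeY2 : Tree :=
    .p 1 3 (.p 0 3 (.d [] [2,3]) (.d [3,2] [])) (.l 2 false [] [3] [2])

def treeY3 : Tree :=
    .p 1 3 (.p 0 3 (.p 3 4 (.d [] [4,2,3]) (.d [] [2,3,4])) (.l 1 false [3,2] [] [0])) (.l 2 false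
    [] [3] [2])

def treeYGe4 : Tree :=
    .p 2 3 (.l 0 false [] [3] [2]) (.p 0 4 (.p 3 4 (.l 5 false [] [3,2] [4]) (.p 1 2 (.l 1 false
    [] [4,3,2] [1]) (.l 3 false [] [2,3,4] []))) (.p 0 3 (.p 2 4 (.l 1 false [4,3,2] [] [0]) (.l 1
    false [4,2,3] [] [0])) (.l 1 false [3,2] [] [0])))

def treeDGe3 : Tree :=
    .p 1 2 (.l 4 false [] [] [2,3]) (.l 2 true [] [2] [3])

def treeYiGe2 : Tree :=
    .p 1 3 (.l 5 true [] [] [3]) (.l 3 false [] [3] [])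

def treeGGe3 : Tree :=
    .p 0 3 (.l 5 false [] [2] [3]) (.l 21 false [3] [] [])

def treeX4 : Tree :=
    .p 2 4 (.p 2 5 (.p 0 4 (.d [5,4,3,2] []) (.p 1 3 (.d [4,3,5] [2]) (.l 0 false [4] [3,5] [2])))
    (.p 1 3 (.p 0 4 (.d [] [4,3,2,5]) (.d [4,3] [2,5])) (.p 0 5 (.d [] [3,4,5,2]) (.l 1 false
    [5,2] [3] [0])))) (.p 1 2 (.p 2 5 (.p 0 4 (.d [] [3,5,4,2]) (.d [4,2] [3,5])) (.p 1 4 (.d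
    [4,2,5] [3]) (.l 2 false [] [4,2,5] [3]))) (.l 2 false [] [2,4] [3]))

def treeX5 : Tree :=
    .p 2 4 (.p 3 5 (.p 2 6 (.p 0 4 (.d [6,3,2,5,4] []) (.p 5 6 (.d [4,5,2,3,6] []) (.d [4,3,6,5,2]
    []))) (.p 4 6 (.p 4 5 (.d [4,3,6,2,5] []) (.d [6,2,5,4,3] [])) (.p 1 2 (.d [] [3,4,6,2,5]) (.l
    2 true [] [2,6,4,3] [5])))) (.p 1 3 (.p 4 6 (.p 2 5 (.d [6,5,3,4] [2]) (.d [6] [2,5,3,4])) (.p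
    1 6 (.d [6,4,3,5] [2]) (.l 2 false [] [6,4,3,5] [2]))) (.l 6 false [] [3,5] [2,4]))) (.p 2 5
    (.p 0 6 (.p 1 3 (.p 2 3 (.d [] [5,3,6,2,4]) (.d [] [6,5,3,2,4])) (.p 2 6 (.d [5,6] [3,2,4])
    (.d [] [3,5,6,2,4]))) (.p 1 3 (.p 1 5 (.p 3 6 (.d [6,5,3] [2,4]) (.d [6,3,5] [2,4])) (.p 2 6
    (.d [6,3,5] [2,4]) (.d [6,2,4] [5,3]))) (.p 4 5 (.p 2 6 (.d [6,4,2] [3,5]) (.l 2 false [6,2,4]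
    [3] [5])) (.d [6] [3,5,4,2])))) (.p 0 4 (.p 1 4 (.p 4 6 (.p 5 6 (.d [5,2,4] [3,6]) (.d []
    [3,6,5,2,4])) (.p 1 5 (.d [5,2,4,6] [3]) (.l 2 false [] [5,2,4,6] [3]))) (.l 2 false []
    [4,2,5] [3])) (.l 3 false [4,2,5] [] [])))

def treeX6 : Tree :=
    .p 2 4 (.p 0 5 (.p 2 6 (.p 0 7 (.p 2 3 (.d [4,3,5,2,7,6] []) (.p 1 2 (.d [] [5,4,7,6,3,2]) (.d
    [] [2,3,4,5,6,7]))) (.p 2 3 (.p 4 7 (.d [7,6,3,4,5,2] []) (.d [7,4,3,6,5,2] [])) (.p 5 7 (.d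
    [7,2,3,4,5,6] []) (.l 2 false [7,5,4,3,2] [] [6])))) (.p 2 7 (.p 0 4 (.d [7,3,4,5,2,6] []) (.p
    2 3 (.d [4,3,7,5,2,6] []) (.d [4,5,7,3,2,6] []))) (.p 1 3 (.p 4 6 (.d [6,2,7] [5,4,3]) (.l 2
    false [] [5,4,6,2,7] [3])) (.p 0 6 (.l 2 false [] [3,4,6,2,7] [5]) (.l 1 false [6,2] [3,4,5]
    [0]))))) (.p 2 6 (.p 4 7 (.p 1 2 (.p 5 7 (.d [5,2] [7,6,3,4]) (.l 0 false [5,7,6] [3,4] [2]))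
    (.p 5 7 (.d [7,6,3,4] [2,5]) (.l 5 true [5,7,6] [2] [4]))) (.p 4 5 (.p 5 7 (.d [5,6,3,4,7,2]
    []) (.l 2 false [5,7,4,3,6] [] [2])) (.p 1 2 (.l 2 true [5,4,7] [3,6] [2]) (.l 2 true [5,4,7]
    [2] [6])))) (.p 3 7 (.p 4 7 (.p 3 5 (.p 5 6 (.d [5,4,3,2,6,7] []) (.d [7,2,6,5,4,3] [])) (.p 1
    2 (.d [5,3,4] [7,2,6]) (.l 2 false [5,3,4] [2,6] [7]))) (.p 3 5 (.p 6 7 (.d [5,6,2,7,4,3] [])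
    (.d [5,2,6,7,4,3] [])) (.d [5,3,4,7,2,6] []))) (.p 3 5 (.p 1 3 (.p 4 5 (.d [5,2,6] [4,3,7])
    (.d [5,4,3,7] [2,6])) (.l 3 false [5,2,6] [3,7] [])) (.p 4 6 (.p 1 2 (.l 2 true [5,3,7] [6,2]
    [4]) (.l 2 true [5,3,7] [2,6] [4])) (.l 3 false [5,3,4,6,2] [] [])))))) (.p 2 5 (.p 0 6 (.p 3
    7 (.p 0 5 (.p 1 3 (.d [] [6,7,5,3,2,4]) (.d [] [3,5,6,7,2,4])) (.p 3 6 (.d [7,6,5,3,2,4] [])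
    (.d [5,3,6,7,2,4] []))) (.p 4 5 (.p 2 6 (.d [5,6,4,2,3,7] []) (.d [4,2,6,5,3,7] [])) (.p 1 3
    (.l 2 false [] [2,4,5,3,7] [6]) (.l 5 false [] [3,5,4,2] [6])))) (.p 3 7 (.p 5 7 (.p 3 6 (.p 4
    6 (.d [6,5,3,2,4,7] []) (.d [7,2,4,6,5,3] [])) (.p 1 2 (.d [6,3,5] [7,2,4]) (.l 2 false
    [6,3,5] [2,4] [7]))) (.p 3 6 (.p 4 7 (.d [6,4,2,7,5,3] []) (.d [6,2,4,7,5,3] [])) (.d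
    [6,3,5,7,2,4] []))) (.p 3 6 (.p 1 3 (.p 5 6 (.d [6,2,4] [5,3,7]) (.d [6,5,3,7] [2,4])) (.l 3
    false [6,2,4] [3,7] [])) (.p 4 5 (.p 1 2 (.l 2 true [6,3,7] [4,2] [5]) (.l 2 true [6,3,7]
    [2,4] [5])) (.l 3 false [6,3,5,4,2] [] []))))) (.p 1 3 (.p 1 4 (.p 1 6 (.p 6 7 (.p 3 6 (.d [6]
    [7,3,4,2,5]) (.d [4,7,3,6] [2,5])) (.p 5 6 (.d [6,7] [2,4,5,3]) (.l 2 true [4,2,5,6,7] []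
    [3]))) (.p 4 6 (.p 3 7 (.d [4,7,2,5] [6,3]) (.d [4,2,5] [6,3,7])) (.l 2 false [] [6,4,2,5]
    [3]))) (.l 2 false [] [4,2,5] [3])) (.p 3 6 (.p 4 6 (.l 2 true [4,2,5] [3] [6]) (.p 2 3 (.l 3
    false [6,4,2,5] [3] []) (.l 1 false [] [3,2,4,6] [3]))) (.p 0 4 (.p 2 6 (.l 3 false []
    [3,6,4,2,5] []) (.l 7 false [] [3,6,2,4] [2])) (.l 3 false [4,2] [3,6] [])))))

def treeXGe7 : Tree :=
    .p 1 2 (.l 20 false [] [3] [2]) (.l 5 false [] [2] [3])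

def treeVt6 : Tree :=
    .p 0 3 (.p 0 4 (.l 18 false [] [3] [2,4]) (.p 2 5 (.p 5 6 (.p 2 7 (.p 3 4 (.d [4,2] [6,7,3,5])
    (.l 0 false [4,3,5] [6,7] [2])) (.p 2 4 (.p 1 7 (.d [4,3,5,7,2] [6]) (.d [6,4,3,5] [7,2])) (.l
    2 true [4,2,7] [3,5] [6]))) (.p 5 7 (.p 3 7 (.d [4] [7,2,3,5,6]) (.p 4 7 (.d [4,2] [7,3,5,6])
    (.l 2 true [4,7,3,5,6] [] [2]))) (.p 2 6 (.p 3 4 (.d [4,2] [3,6,5,7]) (.l 2 true [4,3,6,5,7]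
    [] [2])) (.p 3 7 (.d [4] [3,5,6,2,7]) (.d [4] [3,7,5,6,2]))))) (.p 3 6 (.p 6 7 (.p 3 4 (.p 3 8
    (.d [4,7,8,2,5] [3]) (.d [7,4,2,5] [3,8])) (.p 3 5 (.d [7,5,2,6] [3,4]) (.l 2 false
    [4,3,5,2,6] [] [7]))) (.p 3 4 (.p 5 6 (.d [4,5,2,6,7] [3]) (.d [4,2,5,6,7] [3])) (.p 1 5 (.d
    [5,2,6,7] [3,4]) (.d [4,3] [5,2,6,7])))) (.p 2 7 (.p 5 7 (.p 5 6 (.d [4] [5,2,6,3,7]) (.l 2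
    true [4] [3,6,5,2] [7])) (.p 6 7 (.d [4] [6,3,7,5,2]) (.d [4] [3,6,7,5,2]))) (.p 2 4 (.p 1 5
    (.d [4,5,2,7] [3,6]) (.d [4,3,6] [5,2,7])) (.l 3 false [4,2,5] [3,6] [])))))) (.l 14 true [3]
    [] [2])

def treeVtGe7 : Tree :=
    .p 0 3 (.l 20 false [] [3] [2]) (.l 14 true [3] [] [2])

def treeT16 : Tree :=
    .p 0 4 (.p 0 5 (.p 1 6 (.p 4 7 (.d [6] [4,3,5,7,2]) (.p 2 4 (.d [3,6,4,7] [5,2]) (.p 0 7 (.d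
    [6] [5,3,7,4,2]) (.d [7,4,2] [5,3,6])))) (.p 2 7 (.p 0 3 (.d [7,3,4,2,5] [6]) (.p 2 4 (.d
    [3,4,7,5,2] [6]) (.d [3,5,7,4,2] [6]))) (.p 2 4 (.d [3,4,5,2,7] [6]) (.p 3 6 (.d [6]
    [5,3,4,2,7]) (.l 2 false [] [6,3,4,2,7] [5]))))) (.p 3 6 (.p 2 7 (.p 4 5 (.d [5,2] [6,7,4,3])
    (.l 0 false [5,4,3] [6,7] [2])) (.p 2 5 (.p 5 7 (.d [5,4,3,7,2] [6]) (.d [6,5,7,2] [4,3])) (.l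
    2 true [5,2,7] [4,3] [6]))) (.p 1 7 (.p 4 7 (.d [5] [4,2,7,3,6]) (.p 5 7 (.d [5,2] [4,7,3,6])
    (.l 2 true [5,7,4,3,6] [] [2]))) (.p 2 5 (.p 4 7 (.d [5,4,3,6] [7,2]) (.l 2 false [5]
    [7,4,3,6] [2])) (.p 4 7 (.d [5,2,7] [4,3,6]) (.d [5,2] [7,4,3,6])))))) (.l 13 true [4] []
    [2,3])

def treeT1Ge7 : Tree :=
    .p 0 4 (.l 19 false [] [4] [2,3]) (.l 13 true [4] [] [2,3])

def treeT26 : Tree :=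
    .p 0 4 (.p 1 5 (.p 2 6 (.p 3 7 (.d [7,5,2] [6,4,3]) (.p 0 5 (.d [] [2,5,6,4,3,7]) (.d [5,2]
    [6,4,3,7]))) (.p 1 4 (.p 3 7 (.d [3,4,7,5] [2,6]) (.p 5 6 (.d [5] [2,6,4,3,7]) (.d [5,6]
    [2,4,3,7]))) (.p 5 7 (.p 0 5 (.d [] [4,7,3,5,2,6]) (.d [5,2,6] [4,3,7])) (.p 3 6 (.d [6,2,5,7]
    [4,3]) (.d [] [4,3,6,2,5,7]))))) (.p 3 6 (.p 2 7 (.p 4 5 (.d [6,7,4,3] [5,2]) (.l 0 false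
    [6,7] [5,4,3] [2])) (.p 4 5 (.p 4 6 (.d [6] [5,3,4,2,7]) (.d [6,4,3] [5,2,7])) (.p 0 7 (.d [6]
    [5,4,3,7,2]) (.l 2 true [7,2] [5,4,3] [6])))) (.p 4 5 (.p 4 7 (.p 6 7 (.d [6,3,4] [5,2,7]) (.d
    [] [5,2,7,6,3,4])) (.p 5 7 (.d [7,4,3,6] [5,2]) (.l 2 false [] [5,7,4,3,6] [2]))) (.l 2 false
    [] [5,4,3,6] [2])))) (.l 13 true [4] [] [3,2])

def treeT27 : Tree :=
    .p 0 4 (.p 2 5 (.p 0 6 (.p 3 7 (.p 1 8 (.d [7,8,2] [5,4,3,6]) (.p 2 4 (.d [3,4,7,5,6,2] [8])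
    (.d [7,5,6,3,4,2] [8]))) (.p 4 7 (.p 2 8 (.d [] [5,4,8,6,3,7,2]) (.d [] [5,4,3,6,7,2,8])) (.l
    5 false [] [5,4,7,3,6] [2]))) (.p 5 7 (.p 7 8 (.p 2 7 (.d [6] [5,4,7,3,8,2]) (.d [6]
    [5,4,3,7,2,8])) (.p 4 8 (.d [6] [5,4,3,7,8,2]) (.l 2 true [6] [5,4,8,7,3] [2]))) (.p 3 8 (.p 1
    7 (.p 1 2 (.d [6] [4,3,5,7,2,8]) (.d [6] [2,7,8,5,4,3])) (.p 4 8 (.d [6] [7,5,8,2,4,3]) (.l 2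
    true [6] [7,5,8,4,3] [2]))) (.p 2 6 (.p 4 7 (.d [6,4,3,8] [5,7,2]) (.l 2 false [6] [5,7,4,3,8]
    [2])) (.p 2 8 (.d [6,2] [8,3,4,5,7]) (.l 3 false [6,2,8,3] [5,7] [])))))) (.p 0 6 (.p 4 7 (.p
    2 8 (.d [] [8,4,3,6,7,2,5]) (.p 1 4 (.p 0 5 (.d [3,4] [6,7,5,2,8]) (.d [5] [6,7,3,4,2,8])) (.p
    0 5 (.d [] [4,3,6,7,5,2,8]) (.d [5] [4,3,6,7,2,8])))) (.p 2 7 (.p 2 8 (.p 0 5 (.d []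
    [7,4,3,6,8,5,2]) (.d [5,2] [7,4,3,6,8])) (.p 3 5 (.d [5,2,8] [7,4,3,6]) (.l 2 false []
    [7,4,3,5,2,8] [6]))) (.p 3 5 (.p 1 8 (.d [5,8,2,7,4,3,6] []) (.d [5,2,7,4,3,6] [8])) (.p 1 4
    (.l 1 false [3,5,2,7,4] [6] [0]) (.l 1 false [] [4,7,2,5,3] [2]))))) (.p 2 6 (.p 3 7 (.p 2 8
    (.p 1 2 (.d [6] [4,3,8,7,2,5]) (.d [6,7,8,4,3] [2,5])) (.p 1 5 (.d [7,5,2,8] [6,4,3]) (.l 2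
    false [6,4,3] [5,2,8] [7]))) (.p 5 6 (.p 2 8 (.d [6,4,3,7] [8,5,2]) (.d [5,2,8] [6,4,3,7]))
    (.p 2 7 (.l 1 false [6,5,2] [7,3,4] [0]) (.l 7 false [6,5,2,7,3] [] [2])))) (.p 1 4 (.l 9 true
    [6,2,5] [] [3,4]) (.l 3 false [6,2,5] [4,3] []))))) (.l 13 true [4] [] [3,2])

def treeT28 : Tree :=
    .p 0 4 (.p 2 5 (.l 19 false [] [5,4] [2,3]) (.p 0 6 (.p 4 7 (.p 2 8 (.p 0 9 (.p 2 4 (.d []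
    [4,3,6,7,8,9,2,5]) (.d [] [8,6,7,9,3,4,2,5])) (.d [9] [8,4,3,6,7,2,5])) (.p 5 7 (.p 5 9 (.p 1
    9 (.d [5,2,8] [7,6,3,4,9]) (.d [5] [9,4,3,6,7,2,8])) (.p 1 4 (.d [5,9] [6,7,3,4,2,8]) (.d
    [5,9] [4,3,6,7,2,8]))) (.p 3 8 (.p 1 9 (.d [8,9,2,5,7,6,3,4] []) (.d [8,2,5,7,6,3,4] [9])) (.p
    1 4 (.l 0 false [] [6,3,8,2,5,7] [4]) (.l 1 false [] [4,3,8,2,5,7] [4]))))) (.p 6 8 (.p 0 9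
    (.p 1 6 (.d [3,6,2,5] [9,8,4,7]) (.p 2 7 (.d [] [6,3,4,7,9,8,2,5]) (.d [] [6,3,9,8,4,7,2,5])))
    (.p 1 6 (.p 1 7 (.d [9] [4,7,8,3,6,2,5]) (.d [9] [7,4,8,3,6,2,5])) (.p 2 7 (.d [9]
    [7,6,3,4,8,2,5]) (.l 3 false [9] [6,3,4,7,2,5] [])))) (.p 3 5 (.p 1 7 (.p 1 9 (.d
    [5,9,2,7,4,3,6,8] []) (.d [5,2,7,4,3,6,8] [9])) (.l 3 false [5,2] [7,4,3,6,8] [])) (.p 1 4 (.l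
    3 false [3,5,2,4,7] [6,8] []) (.p 6 7 (.l 3 false [] [4,7,2,5,3,6,8] []) (.l 7 false []
    [4,7,6,3,5,2] [4])))))) (.p 2 6 (.p 2 7 (.p 7 8 (.p 7 9 (.p 2 8 (.d [6] [7,3,4,8,9,2,5]) (.d
    [] [7,4,3,9,6,8,2,5])) (.p 5 6 (.d [5,2] [6,8,3,4,7,9]) (.d [8,3,4,6,5,2] [7,9]))) (.p 4 8 (.p
    3 9 (.d [9,6,4,3] [7,8,2,5]) (.d [6,4,3,9] [7,8,2,5])) (.p 5 6 (.l 0 false [6,4,8,7,5,2] []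
    [3]) (.l 5 true [] [7,8,4,6,5,2] [3])))) (.p 1 8 (.p 3 5 (.p 3 9 (.d [9,8,5,2,7] [6,4,3]) (.d
    [5,8,2,7] [6,4,3,9])) (.l 2 true [6,4,3,5,2,7] [] [8])) (.p 5 6 (.l 3 false [6,4,3,5,2,7] [8]
    []) (.p 0 7 (.l 3 false [6,5,2,7,3,4] [8] []) (.l 3 false [7,2,5,6,4,3] [8] []))))) (.l 14
    true [6,2,5] [] [3])))) (.l 13 true [4] [] [3,2])

def treeT2Ge9 : Tree :=
    .p 2 4 (.l 11 false [] [4] [2,3]) (.p 3 4 (.l 10 false [4,2] [] [3]) (.p 0 3 (.l 16 false []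
    [2,4,3] [2]) (.l 1 false [3,4,2] [] [3])))

def treeDt5 : Tree :=
    .p 3 4 (.p 2 5 (.p 3 6 (.p 2 4 (.d [3,5,4,6,2] []) (.p 1 5 (.d [6,5,4,2] [3]) (.l 0 false
    [4,2] [5,6] [3]))) (.p 3 5 (.p 1 2 (.d [3,6] [5,4,2]) (.d [3,6] [2,4,5])) (.p 4 6 (.d
    [4,5,3,6,2] []) (.l 2 false [4,6,3,5] [] [2])))) (.p 0 5 (.p 4 6 (.p 1 6 (.d [4] [3,5,2,6])
    (.d [4] [6,2,5,3])) (.p 5 6 (.d [4,6,2,5,3] []) (.l 2 false [4,6,5,2] [] [3]))) (.l 6 false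
    [5,2] [] [3,4]))) (.p 0 5 (.p 1 5 (.p 5 6 (.p 0 4 (.d [] [2,6,4,3,5]) (.d [4,3,5] [2,6])) (.p
    1 6 (.d [6,5,3,4] [2]) (.l 2 false [] [6,5,3,4] [2]))) (.l 2 false [] [5,3,4] [2])) (.p 3 5
    (.p 4 5 (.p 5 6 (.p 1 3 (.d [5] [6,2,4,3]) (.d [5] [3,4,2,6])) (.p 1 4 (.d [5,6] [3,4,2]) (.l
    2 true [5,6] [4,3] [2]))) (.l 2 false [5,4,3] [] [2])) (.l 3 false [5,3,4] [] [])))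

def treeDtGe6 : Tree :=
    .p 1 2 (.l 11 false [] [] [2,3]) (.l 5 true [] [2] [3])

def treeHt5 : Tree :=
    .p 2 3 (.l 13 false [] [] [2,3]) (.p 0 4 (.p 2 5 (.p 0 6 (.p 1 4 (.p 2 4 (.d [] [5,4,6,2,3])
    (.d [] [6,5,4,2,3])) (.p 2 6 (.d [5,6] [4,2,3]) (.d [] [4,5,6,2,3]))) (.p 1 4 (.p 1 5 (.p 3 5
    (.d [6] [2,3,4,5]) (.d [6] [2,3,5,4])) (.p 4 6 (.d [6,2,3] [5,4]) (.d [6,4,5] [2,3]))) (.p 4 7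
    (.p 5 7 (.d [7,2,3] [4,5]) (.d [] [4,5,7,2,3])) (.p 0 3 (.d [6] [4,5,3,2]) (.l 2 false [3,2]
    [4,7] [5]))))) (.p 0 3 (.p 1 3 (.p 3 6 (.p 5 6 (.d [5,2,3] [4,6]) (.d [] [4,6,5,2,3])) (.p 1 5
    (.d [5,2,3,6] [4]) (.l 2 false [] [5,2,3,6] [4]))) (.l 2 false [] [3,2,5] [4])) (.l 3 false
    [3,2,5] [] []))) (.p 1 5 (.p 1 2 (.p 1 3 (.p 2 4 (.p 2 6 (.d [4,5,6,3,2] []) (.d [5,4,3,2,6]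
    [])) (.l 5 true [4,2,3] [] [5])) (.p 2 6 (.p 4 5 (.d [5,6] [3,2,4]) (.l 1 false [4,5] [3,2]
    [1])) (.l 3 false [4] [3,2,6] []))) (.l 3 false [4] [2,3] [])) (.p 2 5 (.p 0 3 (.l 3 false [4]
    [5,3,2] []) (.l 7 false [3,2] [5] [0])) (.l 3 false [] [5,2,3] []))))

def treeHtGe6 : Tree :=
    .p 0 3 (.l 9 false [] [] [2,3]) (.l 15 false [3] [] [])

def treePtGe5 : Tree :=
    .p 0 2 (.l 14 false [] [] [2]) (.l 3 false [2] [] [])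

def treeKt6 : Tree :=
    .p 0 3 (.p 4 5 (.p 4 6 (.p 0 4 (.p 0 7 (.p 3 8 (.d [] [4,8,7,5,3,6]) (.p 0 5 (.d []
    [4,7,5,6,3,8]) (.d [5,7,6,3,8] [4]))) (.p 5 8 (.p 4 7 (.d [7,8,6,3,5] [4]) (.l 0 false [7,4]
    [3,6,8] [5])) (.p 5 7 (.d [7,6,3,5,8] [4]) (.l 2 true [7,5,8] [3,6] [4])))) (.l 9 false [4]
    [3] [5,6])) (.p 0 5 (.p 0 7 (.p 3 8 (.p 3 5 (.d [] [3,7,5,8,4,6]) (.d [] [3,5,8,7,4,6])) (.p 3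
    6 (.d [] [5,6,7,4,3,8]) (.l 2 false [] [7,4,6,3,8] [5]))) (.p 5 8 (.p 4 7 (.d [7,8,3,4,6] [5])
    (.l 2 true [7,4,6] [3,8] [5])) (.p 3 7 (.d [7,5,8] [3,4,6]) (.d [7,3,4,6] [5,8])))) (.p 5 7
    (.p 3 4 (.p 4 8 (.p 5 6 (.d [5] [3,7,8,6,4]) (.d [5,6,4] [3,7,8])) (.p 3 6 (.d [5,6,4,8]
    [3,7]) (.l 2 false [5] [3,6,4,8] [7]))) (.l 2 false [5] [3,4,6] [7])) (.p 3 8 (.p 7 8 (.p 4 7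
    (.d [7,5,8] [3,4,6]) (.l 2 true [5,7,4,6] [3] [8])) (.p 4 8 (.d [4,6] [3,5,7,8]) (.l 3 false
    [5,7,8,4,6] [] []))) (.p 4 7 (.p 5 6 (.d [5,7,6,4] [3,8]) (.l 2 false [5,6,4] [3,8] [7])) (.l
    3 false [5,7,4] [3,8] [])))))) (.p 3 6 (.p 0 4 (.p 6 7 (.p 3 8 (.p 6 8 (.d [6] [3,7,8,4,5])
    (.d [7,8,6,4,5] [3])) (.p 3 5 (.d [7,5,4,6] [3,8]) (.l 2 false [7] [4,5,3,8] [6]))) (.p 4 7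
    (.p 0 8 (.d [] [3,7,8,6,4,5]) (.d [8] [3,7,6,4,5])) (.p 0 5 (.l 0 false [] [5,4,7,6] [3]) (.l
    2 false [5,4,7,6] [] [3])))) (.l 2 true [4,5] [3] [6])) (.p 1 4 (.l 3 false [4,5] [3,6] [])
    (.p 0 6 (.l 9 false [] [4,5] [3,6]) (.l 3 false [6,3] [4,5] []))))) (.l 15 false [3] [] [])

def treeKtGe7 : Tree :=
    .p 0 3 (.l 22 false [] [3] [2]) (.l 15 false [3] [] [])

def treeW5 : Tree :=
    .p 0 4 (.p 2 5 (.p 3 6 (.d [] [3,5,4,6,2]) (.p 4 6 (.d [] [4,5,3,6,2]) (.l 0 false []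
    [3,6,4,5] [2]))) (.p 2 6 (.p 2 3 (.d [] [3,6,4,2,5]) (.d [] [4,6,3,2,5])) (.p 3 5 (.p 4 6 (.d
    [] [3,6,2,5,4]) (.l 0 false [] [4,6,2,5] [3])) (.l 2 false [] [3,5,2,6] [4])))) (.p 2 5 (.p 1
    6 (.p 2 7 (.d [4] [3,5,6,7]) (.p 1 7 (.d [4] [3,5,7,2]) (.d [6,5,3] [7,2]))) (.p 2 4 (.p 3 6
    (.d [4,3,5] [6,2]) (.l 0 false [4] [6,3,5] [2])) (.p 3 6 (.d [4,2,6] [3,5]) (.l 1 false [4,2]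
    [6,3] [0])))) (.p 3 6 (.p 6 7 (.p 5 7 (.d [4] [3,5,2,6]) (.d [7,5,2,6] [3])) (.p 1 5 (.d
    [5,2,6,7] [3]) (.d [4] [5,2,6,7]))) (.p 1 5 (.p 2 4 (.d [4,5,2] [3,6]) (.d [4,2,5] [3,6])) (.p
    3 4 (.d [4,2,5] [3,6]) (.l 1 false [4,3] [5,2] [0])))))

def treeW6 : Tree :=
    .p 0 4 (.l 18 false [] [3] [2,4]) (.p 2 5 (.p 5 6 (.p 2 7 (.p 3 4 (.d [4,2] [6,7,3,5]) (.l 0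
    false [4,3,5] [6,7] [2])) (.p 2 4 (.p 1 7 (.d [4,3,5,7,2] [6]) (.d [6,4,3,5] [7,2])) (.l 2
    true [4,2,7] [3,5] [6]))) (.p 5 7 (.p 3 7 (.d [4] [7,2,3,5,6]) (.p 4 7 (.d [4,2] [7,3,5,6])
    (.l 2 true [4,7,3,5,6] [] [2]))) (.p 2 6 (.p 3 4 (.d [4,2] [3,6,5,7]) (.l 2 true [4,3,6,5,7]
    [] [2])) (.p 3 7 (.d [4] [3,5,6,2,7]) (.d [4] [3,7,5,6,2]))))) (.p 3 6 (.p 6 7 (.p 3 4 (.p 3 8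
    (.d [4,7,8,2,5] [3]) (.d [7,4,2,5] [3,8])) (.p 3 5 (.d [7,5,2,6] [3,4]) (.l 2 false
    [4,3,5,2,6] [] [7]))) (.p 3 4 (.p 5 6 (.d [4,5,2,6,7] [3]) (.d [4,2,5,6,7] [3])) (.p 1 5 (.d
    [5,2,6,7] [3,4]) (.d [4,3] [5,2,6,7])))) (.p 2 7 (.p 5 7 (.p 5 6 (.d [4] [5,2,6,3,7]) (.l 2
    true [4] [3,6,5,2] [7])) (.p 6 7 (.d [4] [6,3,7,5,2]) (.d [4] [3,6,7,5,2]))) (.p 2 4 (.p 1 5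
    (.d [4,5,2,7] [3,6]) (.d [4,3,6] [5,2,7])) (.l 3 false [4,2,5] [3,6] [])))))

def treeWGe7 : Tree :=
    .l 20 false [] [3] [2]

def treeZ35 : Tree :=
    .p 1 4 (.p 1 5 (.p 2 6 (.d [] [6,3,4,2,5]) (.p 0 4 (.d [] [3,4,5,2,6]) (.d [4,3,5,2,6] [])))
    (.p 2 6 (.p 0 5 (.d [] [5,6,3,4,2]) (.d [5] [6,3,4,2])) (.p 3 7 (.p 4 6 (.d [6,2,4,3] [5]) (.d
    [] [7,2,6,4,3])) (.p 2 5 (.d [] [5,3,4,2,6]) (.d [] [5,2,4,3,7]))))) (.l 9 false [] [4] [2,3])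

def treeZ36 : Tree :=
    .p 1 4 (.p 1 5 (.p 0 6 (.p 2 7 (.d [] [7,3,4,2,5,6]) (.p 1 3 (.d [] [6,4,3,5,2,7]) (.d []
    [3,4,6,5,2,7]))) (.p 1 7 (.p 4 6 (.d [6,5,2,4,3,7] []) (.d [6,4,2,5,3,7] [])) (.p 2 6 (.d
    [6,3,4,2,5] [7]) (.d [6,2,4,3,5] [7])))) (.p 2 6 (.p 0 7 (.p 2 5 (.d [] [5,3,6,7,4,2]) (.d []
    [5,2,4,3,6,7])) (.p 3 7 (.d [7,2,4,3,6] [5]) (.l 2 false [7,3,4,2] [5] [6]))) (.p 3 7 (.p 0 6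
    (.p 2 5 (.d [] [5,3,4,2,6,7]) (.d [] [5,2,7,6,4,3])) (.l 2 false [6,2,4,3] [5] [7])) (.p 0 6
    (.p 2 5 (.d [] [5,6,2,4,3,7]) (.d [] [5,2,6,4,3,7])) (.d [6,2,4,3,7] [5]))))) (.l 9 false []
    [4] [2,3])

def treeZ37 : Tree :=
    .p 1 4 (.p 1 5 (.p 0 6 (.p 1 7 (.p 2 8 (.d [] [8,3,4,2,5,6,7]) (.p 0 4 (.d [] [3,4,5,6,7,2,8])
    (.d [4,3,5,6,7,2,8] []))) (.p 2 8 (.p 0 4 (.d [5,2,4,3,8,6] [7]) (.d [4,2,5,3,8,6] [7])) (.p 3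
    7 (.d [] [7,6,4,3,5,2,8]) (.d [] [7,3,4,6,5,2,8])))) (.p 1 7 (.p 4 8 (.p 1 2 (.d [6]
    [3,4,2,5,8,7]) (.d [6] [2,4,3,5,8,7])) (.p 5 6 (.d [6,7,2,5,3,4,8] []) (.d [6,5,2,7,3,4,8]
    []))) (.p 2 8 (.p 4 9 (.d [6] [8,3,4,2,5,9]) (.d [6] [8,3,5,2,4,9])) (.p 4 7 (.d [6]
    [7,5,3,4,2,8]) (.d [6] [7,4,3,5,2,8]))))) (.p 2 6 (.p 0 7 (.p 2 8 (.p 0 6 (.d [8,3,2,4,6,7]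
    [5]) (.d [6,3,8,7,4,2] [5])) (.p 3 5 (.d [] [5,7,6,3,4,2,8]) (.d [] [5,3,6,7,4,2,8]))) (.p 6 8
    (.p 2 7 (.p 2 9 (.d [7,8,9,3,4,2] [5]) (.d [7,8] [6,3,4,2,9])) (.l 2 false [7,2,4,3,6] [5]
    [8])) (.p 4 6 (.p 2 5 (.d [7] [2,4,5,3,6,8]) (.d [7] [5,2,4,3,6,8])) (.p 3 7 (.d [7,2,4,3,6,8]
    [5]) (.l 3 false [7,3,4,6,8] [5] []))))) (.p 3 7 (.p 3 8 (.p 5 7 (.p 4 7 (.d [7,2,6]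
    [5,8,4,3]) (.d [5,8,2,6] [7,4,3])) (.p 0 6 (.d [] [5,7,2,8,6,4,3]) (.l 2 false [6,2,4,3] [5,7]
    [8]))) (.p 0 6 (.p 2 5 (.d [] [5,6,7,2,4,3,8]) (.d [] [5,2,7,6,4,3,8])) (.l 3 false
    [6,2,4,3,8] [5] []))) (.p 4 6 (.l 3 false [6,2,4,3,7] [5] []) (.p 3 5 (.l 3 false []
    [5,2,6,4,3,7] []) (.l 7 false [] [5,3,4,6,2] [1])))))) (.l 9 false [] [4] [2,3])

def treeZ38 : Tree :=
    .p 2 4 (.l 17 false [] [4] [2,3]) (.p 3 4 (.l 20 false [] [4,2] [3]) (.p 1 5 (.p 2 6 (.l 1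
    false [] [6,3,4,2,5] [1]) (.p 6 7 (.p 0 6 (.l 1 false [] [7,3,4,2,6,5] [1]) (.l 7 true
    [6,2,4,3,5] [] [0])) (.p 1 3 (.l 3 false [5,3,4,2,6,7] [] []) (.l 3 false [] [3,4,2,6,7]
    [])))) (.p 2 5 (.l 7 false [] [5,3,4,2] [1]) (.l 14 false [] [5,2,4] [3]))))

def treeZ3Ge9 : Tree :=
    .p 2 4 (.l 17 false [] [4] [2,3]) (.p 3 4 (.l 20 false [] [4,2] [3]) (.p 1 2 (.l 16 false []
    [3,4,2] [1]) (.l 7 false [] [2,4,3] [1])))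

def treeZ16 : Tree :=
    .p 0 4 (.l 17 false [] [3] [2,4]) (.p 2 5 (.p 3 6 (.p 5 7 (.p 6 7 (.d [4] [3,5,6,2,7]) (.p 3 8
    (.d [4] [3,7,6,5,8]) (.d [4] [5,6,7,3,8]))) (.p 2 4 (.p 6 7 (.d [4,6,5,7,2] [3]) (.l 0 false
    [4,6,7,5] [3] [2])) (.p 1 6 (.d [4,2,6,5,7] [3]) (.l 2 false [4,2] [6,5,7] [3])))) (.p 5 7 (.p
    2 4 (.p 6 7 (.d [4,7,3,6,2] [5]) (.l 0 false [4,7,6,3] [5] [2])) (.p 1 7 (.d [4,2,7,3,6] [5])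
    (.l 2 false [4,2] [7,3,6] [5]))) (.p 1 6 (.p 4 5 (.d [4,3,6,2] [5,7]) (.d [4,5,7] [3,6,2]))
    (.p 0 7 (.l 2 true [4] [6,3,7,5] [2]) (.l 0 false [7,5] [6,3] [2]))))) (.p 3 6 (.p 2 4 (.p 2 7
    (.p 5 7 (.d [4,6,7] [3,5,2]) (.l 0 false [4,6] [7,5,2] [3])) (.p 4 5 (.d [4,6] [3,5,2,7]) (.l
    2 true [4,5,2,7] [3] [6]))) (.l 2 true [4,2,5] [3] [6])) (.p 1 6 (.l 3 false [4] [3,6,2,5] [])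
    (.p 0 5 (.l 3 false [4] [6,3,5,2] []) (.l 7 false [5,2] [6,3] [0])))))

def treeZ1Ge7 : Tree :=
    .l 10 false [] [3] [2]

def treeYt6 : Tree :=
    .p 2 3 (.l 19 false [] [] [2,3]) (.p 1 4 (.p 0 5 (.p 1 6 (.p 0 7 (.p 1 5 (.d [] [7,4,5,6,2,3])
    (.d [] [5,4,7,6,2,3])) (.p 4 7 (.d [7,6,5,4,2,3] []) (.d [7,4,5,6,2,3] []))) (.p 5 7 (.p 0 3
    (.p 2 6 (.d [] [6,5,4,2,3,7]) (.d [] [6,2,7,3,4,5])) (.l 2 false [3,2,4,5] [6] [7])) (.p 4 6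
    (.p 3 6 (.d [6] [3,2,4,5,7]) (.d [] [6,3,2,4,5,7])) (.p 3 4 (.d [3,2] [6,4,5,7]) (.l 5 false
    [] [6,4,3,2] [5]))))) (.p 4 6 (.p 1 3 (.p 1 7 (.p 5 7 (.d [5,4,2,3,6,7] []) (.l 0 false
    [5,7,2,3,6] [] [4])) (.p 3 7 (.d [5] [7,4,2,3,6]) (.l 2 true [5] [7,3,2,4] [6]))) (.l 2 true
    [5] [3,2,4] [6])) (.p 1 7 (.p 5 7 (.p 3 5 (.d [5,4,6] [3,2,7]) (.l 2 true [5,3,2,4,6] [] [7]))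
    (.p 3 7 (.d [5,7,2,3,4,6] []) (.d [5,7,3,2,4,6] []))) (.p 0 3 (.p 2 5 (.d [5,3,2,4,6] [7]) (.d
    [5,2,3,4,6] [7])) (.l 3 false [3,2,4,6] [7] []))))) (.p 2 5 (.p 0 6 (.p 3 5 (.p 6 7 (.p 5 7
    (.d [5,6,3,2,7] [4]) (.d [3,2,7,5,6] [4])) (.p 4 6 (.d [3,2,4] [5,6,7]) (.l 2 false [3,2]
    [4,6,7] [5]))) (.p 4 6 (.p 5 7 (.d [7] [4,2,3,5,6]) (.l 2 false [] [4,2,3,5,7] [6])) (.l 3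
    false [] [4,6,5,3,2] []))) (.p 5 7 (.p 2 6 (.p 2 8 (.p 3 5 (.d [6,7,8,3,2] [4]) (.d [6,7,8]
    [5,3,2])) (.p 3 6 (.d [6,7] [5,3,2,8]) (.d [7,6,3,2,8] [4]))) (.p 4 7 (.p 3 4 (.l 0 false
    [6,2,3,5] [4] [7]) (.l 0 false [6,2,3,4] [5] [7])) (.l 0 false [6,2] [4,7] [5]))) (.p 3 5 (.p
    3 6 (.p 4 6 (.d [6,2,3] [4,5,7]) (.d [3,2,6,4] [5,7])) (.p 3 7 (.d [6,3,2,7,5] [4]) (.l 2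
    false [6,3,7,5] [4] [2]))) (.p 2 6 (.p 0 7 (.d [6,7,5,3,2] [4]) (.l 2 false [7,5,3,2] [4]
    [6])) (.l 3 false [6,2,3,5] [4] []))))) (.p 0 6 (.p 0 3 (.p 3 4 (.p 3 7 (.p 0 5 (.d []
    [4,6,7,5,2,3]) (.d [5] [4,6,7,2,3])) (.p 4 7 (.d [7,3,2,5] [4,6]) (.l 2 false [] [4,7,3,2,5]
    [6]))) (.l 2 false [] [4,3,2,5] [6])) (.l 3 false [3,2,5] [4] [])) (.p 6 7 (.p 4 7 (.p 3 6 (.l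
    2 false [6] [4,3,2,5] [7]) (.l 2 true [6,3,2,5] [4] [7])) (.p 2 6 (.p 0 3 (.d [6,3,2,5] [4,7])
    (.l 2 true [3,2,5] [4,7] [6])) (.l 3 false [6,2,3] [4,7] []))) (.p 3 7 (.p 5 7 (.p 3 4 (.d
    [6,7] [4,5,2,3]) (.l 2 true [6] [4,3,2,5] [7])) (.l 3 false [6,7,5,2] [4] [])) (.l 1 false
    [6,7,3,2] [] [0]))))))

def treeYt7 : Tree :=
    .p 2 3 (.l 19 false [] [] [2,3]) (.p 1 4 (.p 1 5 (.p 0 6 (.p 0 7 (.p 1 8 (.p 0 4 (.d []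
    [6,4,5,7,8,2,3]) (.d [4,6,5,7,8,2,3] [])) (.p 6 8 (.d [] [8,7,4,6,5,2,3]) (.d []
    [8,6,4,7,5,2,3]))) (.p 3 6 (.p 4 8 (.d [7] [3,2,4,6,5,8]) (.d [7] [3,2,5,6,4,8])) (.p 2 7 (.l
    5 true [7,6,3,2,4] [] [5]) (.l 2 true [7,2,3,6,4] [] [5])))) (.p 1 7 (.p 4 8 (.p 4 5 (.d [6]
    [8,5,7,4,2,3]) (.p 4 6 (.d [6,7,8,5,4,2,3] []) (.d [6,4,5,8,7,2,3] []))) (.p 3 5 (.p 6 7 (.d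
    [6,5,2,7,3,4,8] []) (.l 2 true [6,7,2,3,4,8] [] [5])) (.p 4 6 (.l 2 true [6,5,3,2,4,8] [] [7])
    (.l 5 true [6,4,2,3,5] [] [7])))) (.p 4 7 (.p 4 8 (.p 3 7 (.d [6] [7,5,8,3,2,4]) (.l 2 true
    [6] [7,3,2,5,8] [4])) (.p 3 5 (.d [6] [7,5,2,3,4,8]) (.d [6] [7,5,3,2,4,8]))) (.l 3 false [6]
    [7,4,2,3] [])))) (.p 4 6 (.p 6 7 (.p 4 5 (.p 4 8 (.p 3 5 (.d [6] [5,7,8,3,2,4]) (.l 0 false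
    [8,7] [5,3,2,4] [6])) (.p 3 5 (.d [6,3,2,4,8] [5,7]) (.l 2 false [6] [5,3,2,4,8] [7]))) (.l 2
    false [6] [5,4,2,3] [7])) (.p 0 7 (.l 3 false [6,7,4,2,3] [5] []) (.p 1 3 (.l 3 false
    [7,6,3,2,4] [5] []) (.l 7 true [7,6] [3,2,4] [1])))) (.p 3 4 (.l 3 false [3,2,4,6] [5] []) (.p
    0 6 (.p 2 5 (.l 7 false [] [5,6,4,3,2] [1]) (.l 3 false [] [5,2,3,4,6] [])) (.l 1 false
    [6,4,3,2] [] [0]))))) (.p 2 5 (.p 5 6 (.p 6 7 (.p 5 8 (.p 6 8 (.p 4 8 (.d [6] [4,5,7,8,2,3])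
    (.d [6,2,3] [4,8,7,5])) (.p 3 7 (.d [6,8,7,2,3,5] [4]) (.l 2 false [6,8,7,3,2] [4] [5]))) (.p
    2 4 (.p 4 7 (.d [7,5,8] [4,6,2,3]) (.d [6,4,7,2,3] [5,8])) (.p 3 7 (.l 2 false [6] [4,2,3,5,8]
    [7]) (.l 5 false [6] [4,2,3,7] [5])))) (.p 4 6 (.p 5 8 (.p 2 7 (.d [6,7,8,4,2,3] [5]) (.l 2
    true [6,7,2,3] [4,8] [5])) (.p 5 7 (.d [6,7,4,2,3] [5,8]) (.d [6,7,5,8] [4,2,3]))) (.p 0 3 (.p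
    2 7 (.l 5 true [] [4,6,7,3,2] [5]) (.l 7 false [] [4,6,7,2,3] [1])) (.l 0 false [3,2] [4,6]
    [5])))) (.p 2 7 (.p 4 5 (.p 4 6 (.p 7 8 (.d [8,5,6,2,3] [4,7]) (.d [4,7,8] [5,6,2,3])) (.p 0 3
    (.l 5 true [] [4,6,5,3,2] [7]) (.l 2 false [3,2] [4,6,5] [7]))) (.p 3 5 (.l 2 false [3,2]
    [4,5,6] [7]) (.l 5 true [] [4,5,3,2] [7]))) (.p 0 3 (.p 5 7 (.l 3 false [7,2,3,5,6] [4] [])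
    (.p 2 4 (.l 3 false [] [4,3,2,7,5,6] []) (.l 2 false [] [4,2,7,5,6] [3]))) (.l 3 false [3,2,7]
    [5,6] [])))) (.p 0 6 (.p 4 6 (.p 3 4 (.p 4 7 (.p 7 8 (.p 6 7 (.d [7] [4,8,6,3,2,5]) (.d
    [3,8,6,7] [4,2,5])) (.p 5 7 (.d [7,8] [4,2,3,5,6]) (.l 2 true [3,2,5,7,8] [4] [6]))) (.p 3 7
    (.p 6 8 (.d [3,8,2,5] [4,7,6]) (.d [3,2,5] [4,7,6,8])) (.l 2 false [] [4,7,3,2,5] [6]))) (.l 2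
    false [] [4,3,2,5] [6])) (.p 6 7 (.p 3 7 (.l 2 true [3,2,5] [4,6] [7]) (.p 2 6 (.l 3 false
    [7,3,2,5] [4,6] []) (.l 1 false [] [4,6,2,3,7] [6]))) (.p 0 3 (.p 2 7 (.l 3 false []
    [4,6,7,3,2,5] []) (.l 7 false [] [4,6,7,2,3] [1])) (.l 3 false [3,2] [4,6,7] [])))) (.p 3 4
    (.p 3 6 (.p 5 6 (.l 7 false [6] [4,5,2,3] [5]) (.l 3 false [6,5,2,3] [4] [])) (.l 3 false
    [6,3,2,5] [4] [])) (.l 3 false [] [4,3,2,5] [])))))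

def treeYt8 : Tree :=
    .p 1 3 (.p 2 4 (.p 2 5 (.p 4 6 (.p 2 7 (.p 0 8 (.p 0 9 (.d [] [4,8,5,6,7,9,3,2]) (.p 3 4 (.d
    [9] [2,3,5,6,7,8,4]) (.d [9] [5,6,7,8,4,3,2]))) (.p 5 9 (.p 3 4 (.d [8] [2,3,5,6,7,9,4]) (.d
    [8] [5,6,7,9,4,3,2])) (.p 3 7 (.p 4 7 (.d [8] [4,3,2,6,7,5,9]) (.d [8] [2,3,4,7,6,5,9])) (.p 6
    8 (.d [8,2,3,7,6,5,9] [4]) (.l 2 true [8,6,5,9] [7,3,2] [4]))))) (.p 5 8 (.p 4 9 (.p 6 7 (.d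
    [6,5,9,7,2,3] [4,8]) (.d [9,5,6,7,2,3] [4,8])) (.p 6 8 (.p 3 6 (.d [6,5,3,2,7] [8,4,9]) (.d
    [8,4,9] [5,6,3,2,7])) (.p 3 5 (.d [3,2,7] [5,6,8,4,9]) (.d [6,8,4,9] [5,3,2,7])))) (.p 4 9 (.p
    2 8 (.p 3 5 (.d [6,5,8,9] [4,3,2,7]) (.d [6,8,9,5,3,2,7] [4])) (.p 0 7 (.d [6]
    [4,7,3,2,8,5,9]) (.l 5 true [7,2,8,5,6] [4] [9]))) (.p 3 4 (.p 3 9 (.d [3,2,7] [4,9,6,5,8])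
    (.d [4,9,3,2,7] [6,5,8])) (.p 0 9 (.d [6,5,8] [4,9,3,2,7]) (.l 3 false [9,4,3,2,7] [5,8]
    [])))))) (.p 5 7 (.p 5 8 (.p 2 9 (.p 5 9 (.d [7,9,8,2,3] [5,4,6]) (.p 2 7 (.d [5,9,7,8,2,3]
    [4,6]) (.d [7,2,3] [5,9,8,4,6]))) (.p 2 6 (.p 3 4 (.d [7,4,6,8] [5,3,2,9]) (.d [7,6,8,4,3,2,9]
    [5])) (.p 0 9 (.d [7] [5,9,3,2,6,4,8]) (.l 5 true [9,2,6,4,7] [5] [8])))) (.p 5 9 (.p 2 7 (.p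
    3 7 (.d [3,2,9,7,4,6] [5,8]) (.d [5,8] [7,3,2,9,4,6])) (.p 8 9 (.d [9,4,6] [5,8,7,2,3]) (.d
    [7,2,3] [5,8,9,4,6]))) (.p 1 8 (.p 6 8 (.d [6,3,2,8,5,9] [4,7]) (.d [7,4,6,8,2,3] [5,9])) (.p
    6 7 (.d [7,4,6,2,3] [8,5,9]) (.l 2 false [7,6,4] [8,5,9] [2]))))) (.p 4 8 (.p 4 9 (.p 2 8 (.p
    3 8 (.d [3,2,9,8,5,7] [4,6]) (.d [4,6] [8,3,2,9,5,7])) (.p 7 9 (.d [9,5,7,8,2,3] [4,6]) (.d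
    [9,7,5,8,2,3] [4,6]))) (.p 1 6 (.p 6 7 (.d [7,3,2,6,4,9] [5,8]) (.d [8,5,7,6,2,3] [4,9])) (.p
    8 9 (.d [8,5,7] [6,4,9,2,3]) (.l 2 false [] [6,4,9,8,5,7] [2])))) (.p 0 6 (.p 1 8 (.p 0 9 (.d
    [] [4,6,3,2,8,9,5,7]) (.d [9] [4,8,2,3,6,5,7])) (.p 6 7 (.l 1 false [] [8,4,6,3,2,7,5] [2])
    (.l 0 false [] [8,4,6,7,5] [2]))) (.p 1 7 (.l 3 false [6,4,8] [5,7,2,3] []) (.l 2 true [6,4,8]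
    [7,5] [2])))))) (.p 6 7 (.p 4 6 (.p 7 8 (.p 6 9 (.p 3 9 (.d [9,8,4,3,7,2,5] [6]) (.p 4 5 (.d
    [6] [4,8,9,3,2,5,7]) (.l 0 false [6] [4,5,2,3,9,8] [7]))) (.p 3 8 (.p 3 4 (.d [3,2,5]
    [7,4,8,6,9]) (.d [8,4,3,6,9] [7,2,5])) (.p 4 5 (.d [6,9] [4,8,3,2,5,7]) (.l 2 true [6,9]
    [4,5,2,3,8] [7])))) (.p 5 7 (.p 6 9 (.p 3 7 (.d [6] [4,3,9,5,2,7,8]) (.d [6] [4,5,9,2,3,7,8]))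
    (.p 3 7 (.d [6,9] [5,4,3,2,7,8]) (.d [6,9] [4,5,2,3,7,8]))) (.p 2 9 (.p 3 4 (.d [4]
    [6,9,3,2,5,7,8]) (.d [6,9] [4,3,2,5,7,8])) (.p 0 9 (.d [6] [4,9,3,2,5,7,8]) (.l 2 true
    [9,2,5,7,8] [4] [6]))))) (.p 7 8 (.p 8 9 (.p 3 7 (.p 5 6 (.d [7] [4,6,9,3,2,5,8]) (.l 0 false
    [7] [4,6,5,2,3,9] [8])) (.p 0 7 (.d [9,6,4,7,3] [8,2,5]) (.l 2 true [7,3,2,5] [4,6,9] [8])))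
    (.p 0 9 (.p 0 8 (.d [6,4] [7,9,8,3,2,5]) (.l 2 true [8,9,3,2,5] [4,6] [7])) (.p 3 8 (.l 2
    false [9,8] [4,6,3,2,5] [7]) (.l 2 true [9,8,3,2,5] [4,6] [7])))) (.p 0 8 (.p 0 7 (.p 0 9 (.d
    [] [4,7,8,3,9,6,2,5]) (.d [9] [4,6,8,7,3,2,5])) (.l 3 false [7,8,3,2,5] [4,6] [])) (.p 1 5 (.p
    5 6 (.l 1 false [8,7] [4,6,3,2,5] [6]) (.l 3 false [8,7] [4,6,5,2,3] [])) (.p 2 6 (.l 7 false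
    [8,7,4,6] [5,2] [7]) (.l 3 false [8,7] [5,2,6,4] [])))))) (.p 0 6 (.p 8 9 (.p 0 5 (.p 0 8 (.d
    [] [4,8,3,2,5,9,6,7]) (.l 2 false [8] [4,5,2,3,6,7] [9])) (.p 2 8 (.l 2 true [5,2,3,6,7] [4,9]
    [8]) (.l 2 false [5,2,8] [4,6,7] [9]))) (.p 3 7 (.p 1 8 (.d [7,8,9] [4,6,3,2,5]) (.l 3 false
    [7,6,3,2,5] [8,9] [])) (.p 3 8 (.d [8,9] [4,6,7,3,2,5]) (.l 2 false [] [4,6,7,3,8,9] [2]))))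
    (.p 8 9 (.p 3 8 (.p 1 5 (.p 3 4 (.d [6,7] [9,4,5,8,2,3]) (.l 2 true [6,7] [4,3,2,5,8] [9]))
    (.l 6 true [6,7] [5,2,3] [8,9])) (.p 3 7 (.p 1 5 (.l 2 false [6,7,5,2,3,8] [4] [9]) (.l 2 true
    [6,7] [5,2,3,8] [9])) (.l 8 false [6,7,3,8] [4] [9,2]))) (.p 2 8 (.p 3 4 (.p 1 9 (.d [6,7]
    [4,9,8,3,2,5]) (.l 3 false [6,7] [9,8,3,2,5] [])) (.p 4 7 (.d [6,7,8,9] [4,3,2,5]) (.l 3 false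
    [6,7,4,3,2] [8,9] []))) (.p 3 4 (.p 1 9 (.l 3 false [6,7] [4,9,8,2,5] []) (.l 6 true [6,7]
    [9,8,2] [4,3])) (.l 3 false [6,7] [4,3,2,8,9] []))))))) (.p 0 5 (.p 1 6 (.p 0 7 (.p 1 8 (.p 0
    9 (.p 1 5 (.d [] [7,3,5,6,9,8,2,4]) (.d [] [5,3,7,6,9,8,2,4])) (.p 3 9 (.d [9,6,5,3,7,8,2,4]
    []) (.d [9,3,5,6,7,8,2,4] []))) (.p 3 4 (.p 5 9 (.d [4,2,3,5,6,7,9] [8]) (.d [4,2,3,7,6,5,9]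
    [8])) (.p 3 8 (.l 5 false [] [8,6,2,4,3,5] [7]) (.l 9 false [] [8,3,4,2] [5,7])))) (.p 3 8 (.p
    2 7 (.p 3 9 (.d [8,6,9] [7,5,3,2,4]) (.d [8,6,2,4] [7,5,3,9])) (.p 4 6 (.l 1 false
    [7,2,4,3,5,6,8] [] [3]) (.l 6 true [7,2,4,6,5] [] [3,8]))) (.p 2 8 (.l 3 false [7]
    [8,3,5,6,2,4] []) (.p 3 7 (.l 3 false [7,6,5,3,8,2,4] [] []) (.l 2 true [7,3,8,2,4] []
    [6]))))) (.p 7 8 (.p 0 7 (.p 4 8 (.p 7 9 (.d [4,9,2,8,5,3,7] [6]) (.d [4,2,8,5,3,7,9] [6]))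
    (.p 2 6 (.l 0 false [] [6,5,3,2,4,8] [7]) (.l 9 false [] [6,2,4,8] [5,7]))) (.p 2 6 (.l 2
    false [7] [6,5,3,2,4] [8]) (.p 5 7 (.l 9 false [7] [6,2,4] [5,8]) (.l 3 false [7,5,3] [6,2,4]
    [])))) (.p 2 7 (.p 3 8 (.l 3 false [8,7,5,3,2,4] [6] []) (.p 3 4 (.l 3 false [4,2,3,8,7,5] [6]
    []) (.l 5 false [] [7,8,3,4,2] [5]))) (.p 0 8 (.p 6 8 (.l 3 false [] [6,5,3,8,7,2,4] []) (.l 2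
    false [] [6,8,7,2,4] [5])) (.l 3 false [8,7,2,4] [6] []))))) (.p 3 6 (.p 6 7 (.p 3 8 (.p 8 9
    (.p 3 7 (.p 4 6 (.d [5] [6,9,7,8,4,2,3]) (.d [5] [9,7,8,6,4,2,3])) (.p 5 8 (.d [8,7,3,2,4]
    [5,6,9]) (.d [5,8,7,3,2,4] [9,6]))) (.p 4 6 (.p 4 5 (.d [6] [4,2,3,5,7,8,9]) (.l 2 false
    [5,4,2,3] [7,8,9] [6])) (.p 1 9 (.l 2 true [5] [7,8,9,2,4,6] [3]) (.l 1 false [6,4,2,3]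
    [9,8,7] [6])))) (.p 1 8 (.p 3 5 (.p 6 9 (.d [6,8,3,2,4] [7,5,9]) (.d [6,9] [7,5,8,3,2,4])) (.l
    2 true [5,3,8,2,4] [7] [6])) (.p 5 6 (.l 6 false [5] [8,3,2,4] [6,7]) (.l 2 false [5,6]
    [8,3,2,4] [7])))) (.p 3 8 (.p 5 6 (.p 5 7 (.p 8 9 (.d [5,8] [9,6,7,3,2,4]) (.d [6,7,3,2,4]
    [5,8,9])) (.p 4 6 (.l 5 true [5,7,6] [4,2,3] [8]) (.l 6 true [5,7,6,4,2] [] [3,8]))) (.p 4 6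
    (.l 2 true [5,6,7] [4,2,3] [8]) (.l 5 false [5,6,4,2,3] [] [8]))) (.p 1 8 (.p 2 7 (.l 3 false
    [5] [7,6,8,3,2,4] []) (.p 5 8 (.l 3 false [5,3,8,6,7,2,4] [] []) (.l 1 false [5,8,3,2,7,6] []
    [3]))) (.l 3 false [6,7] [8,3,2,4] [])))) (.p 2 6 (.l 3 false [5] [6,3,2,4] []) (.p 1 4 (.p 4
    5 (.l 7 false [5,3,6,2,4] [] [5]) (.l 3 false [5,4,2,6,3] [] [])) (.l 1 false [] [4,2,6,3]
    [1])))))) (.l 14 false [] [3] [2])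

def treeYtGe9 : Tree :=
    .p 2 3 (.l 19 false [] [] [2,3]) (.p 1 4 (.p 3 4 (.l 22 false [3,2,4] [] [3]) (.p 0 4 (.l 16
    false [] [2,3,4] [1]) (.l 1 false [4,3,2] [] [0]))) (.p 0 3 (.p 2 4 (.l 22 false [] [4,3,2]
    [1]) (.l 20 false [] [4,2] [3])) (.l 16 false [3,2] [] [0])))

def treeOGe2 : Tree :=
    .p 0 2 (.l 5 false [] [] [2]) (.l 3 false [2] [] [])

def treeYitGe6 : Tree :=
    .p 1 3 (.l 20 true [] [] [3]) (.l 15 false [] [3] [])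

/-- The list of all patterns with their certificates. -/
def pats : List Pat :=
  [⟨[(0, 2), (1, 2)], [], 3, 2, 1, [treeV1, treeV2], treeVGe3⟩,
   ⟨[(0, 2), (1, 2)], [2], 3, 3, 1, [treeK1, treeK2], treeKGe3⟩,
   ⟨[(0, 2)], [], 3, 3, 1, [treeH1], treeHGe2⟩,
   ⟨[], [], 2, 4, 1, [treeP1], treePGe2⟩,
   ⟨[(0, 2), (2, 3), (1, 2)], [], 4, 1, 3, [treeU13], treeU1Ge4⟩,
   ⟨[(0, 1), (0, 2)], [], 3, 2, 2, [treeY2, treeY3], treeYGe4⟩,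
   ⟨[(0, 2), (2, 3)], [], 4, 2, 3, [], treeDGe3⟩,
   ⟨[(0, 1), (0, 2)], [2], 3, 3, 2, [], treeYiGe2⟩,
   ⟨[(0, 2), (1, 3)], [], 4, 2, 3, [], treeGGe3⟩,
   ⟨[(0, 2), (0, 3)], [], 4, 1, 4, [treeX4, treeX5, treeX6], treeXGe7⟩,
   ⟨[(0, 2), (1, 2)], [], 3, 1, 6, [treeVt6], treeVtGe7⟩,
   ⟨[(0, 2), (2, 3), (1, 2)], [], 4, 0, 6, [treeT16], treeT1Ge7⟩,
   ⟨[(0, 2), (2, 3), (1, 3)], [], 4, 0, 6, [treeT26, treeT27, treeT28], treeT2Ge9⟩,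
   ⟨[(0, 2), (2, 3)], [], 4, 1, 5, [treeDt5], treeDtGe6⟩,
   ⟨[(0, 2)], [], 3, 2, 5, [treeHt5], treeHtGe6⟩,
   ⟨[], [], 2, 3, 5, [], treePtGe5⟩,
   ⟨[(0, 2), (1, 2)], [2], 3, 2, 6, [treeKt6], treeKtGe7⟩,
   ⟨[(0, 2), (1, 2), (0, 3)], [], 4, 0, 5, [treeW5, treeW6], treeWGe7⟩,
   ⟨[(0, 1), (0, 2), (0, 3)], [], 4, 0, 5, [treeZ35, treeZ36, treeZ37, treeZ38], treeZ3Ge9⟩,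
   ⟨[(0, 1), (0, 2), (2, 3)], [], 4, 0, 6, [treeZ16], treeZ1Ge7⟩,
   ⟨[(0, 1), (0, 2)], [], 3, 1, 6, [treeYt6, treeYt7, treeYt8], treeYtGe9⟩,
   ⟨[(0, 1)], [], 2, 3, 2, [], treeOGe2⟩,
   ⟨[(0, 1), (0, 2)], [2], 3, 2, 6, [], treeYitGe6⟩]

def treeStart : Tree :=
    .p 0 1 (.p 0 2 (.p 1 3 (.l 12 false [2] [3] [0,1]) (.l 13 false [1] [3] [0,2])) (.l 14 false
    [0] [2] [1])) (.l 15 false [0] [1] [])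

/-! ### The certificate checker -/

def adj (R : List (ℕ × ℕ)) (x y : ℕ) : Bool :=
  R.any fun e => (e.1 == x && e.2 == y) || (e.1 == y && e.2 == x)

/-- There is a path `x, p, q, y` in `R`. -/
def isForced (R : List (ℕ × ℕ)) (x y : ℕ) : Bool :=
  x != y && R.any fun e =>
    (e.1 != x && e.2 != x && e.1 != y && e.2 != y && e.1 != e.2) &&
      ((adj R x e.1 && adj R e.2 y) || (adj R x e.2 && adj R e.1 y))

/-- Lengthen the path from its end `a`; returns the new end, the new list of names which may be on
the path, and the number of remaining moves. -/
def ext (R B : List (ℕ × ℕ)) : ℕ → List ℕ → ℕ → List ℕ → Option (ℕ × List ℕ × ℕ)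
  | a, vis, e, [] => some (a, vis, e)
  | a, vis, e, x :: xs =>
    if vis.elem x then none
    else if adj B a x then ext R B x (x :: vis) e xs
    else if isForced R a x then
      match e with
      | 0 => none
      | e + 1 => ext R B x (x :: vis) e xs
    else none

/-- The ends of the path and the names which may be on it, before lengthening. -/
def ends : Option (List ℕ) → List ℕ → Option (ℕ × ℕ × List ℕ × List ℕ)
  | none, [] => none
  | none, v :: xs => some (v, v, [v], xs)
  | some inn, xs => some (0, 1, 0 :: 1 :: inn, xs)

/-- Lengthen at both ends. -/
def ext2 (st : Option (List ℕ)) (R B : List (ℕ × ℕ)) (e : ℕ) (xs ys : List ℕ) :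
    Option (ℕ × ℕ × List ℕ × ℕ × ℕ) :=
  match ends st xs with
  | none => none
  | some (a, b, vis, xs') =>
    match ext R B a vis e xs' with
    | none => none
    | some (a', vis', e') =>
      match ext R B b vis' e' ys with
      | none => none
      | some (b', vis'', e'') => some (a', b', vis'', e'', xs'.length + ys.length)

def pat (q : ℕ) : Pat := pats.getD q ⟨[], [], 0, 0, 0, [], .d [] []⟩

/-- Does pattern `q'` match? -/
def matchPat (q' : ℕ) (R : List (ℕ × ℕ)) (vis ns : List ℕ) : Bool :=
  ns.length == (pat q').sz && decide ns.Nodup &&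
  ((List.range (pat q').sz).all fun i =>
    decide (i < 2) || (pat q').inn.elem i || !(vis.elem (ns.getD i 0))) &&
  (pat q').red.all fun e => adj R (ns.getD e.1 0) (ns.getD e.2 0)

def chk (st : Option (List ℕ)) (q r : ℕ) (sym : Bool) :
    Tree → List (ℕ × ℕ) → List (ℕ × ℕ) → ℕ → Bool
  | .p _ _ _ _, _, _, 0 => false
  | .p i j t₁ t₂, R, B, e + 1 =>
    i != j && chk st q r sym t₁ ((i, j) :: R) B e && chk st q r sym t₂ R ((i, j) :: B) e
  | .l q' sw xs ys g, R, B, e =>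
    match ext2 st R B e xs ys with
    | none => false
    | some (a, b, vis, e', k) =>
      decide (q' < pats.length) && decide (k + (pat q').rmin ≤ r) &&
      decide (2 * (r - k) + (pat q').cc ≤ e' + 2) && (decide (0 < k) || decide (q' < q)) &&
      matchPat q' R vis (if sw then b :: a :: g else a :: b :: g)
  | .d xs ys, R, B, e =>
    match ext2 st R B e xs ys with
    | none => false
    | some (_, _, _, _, k) => !sym && decide (r ≤ k)

def chkBase (q : ℕ) : ℕ → List Tree → Bool
  | _, [] => true
  | r, t :: ts =>
    chk (some (pat q).inn) q r false t (pat q).red [] (2 * r + (pat q).cc - 2) &&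
      chkBase q (r + 1) ts

/-- Check all certificates of pattern `q`. -/
def chkPat (q : ℕ) : Bool :=
  decide (1 ≤ (pat q).rmin) && decide (2 ≤ (pat q).sz) &&
  ((pat q).red.all fun e => decide (e.1 < (pat q).sz) && decide (e.2 < (pat q).sz)) &&
  chkBase q (pat q).rmin (pat q).base &&
  chk (some (pat q).inn) q ((pat q).rmin + (pat q).base.length) true (pat q).sym (pat q).red []
    (2 * ((pat q).rmin + (pat q).base.length) + (pat q).cc - 2)

def chkAll : ℕ → Bool
  | 0 => true
  | q + 1 => chkPat q && chkAll q

theorem chkAll_ok : chkAll 23 = true := by decide +kernel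

theorem chkStart_ok : chk none 100 7 true treeStart [] [] 14 = true := by decide +kernel

/-! ### Soundness of the checker -/

/-- The named edges have the recorded colours. -/
def Facts (f : ℕ → ℕ) (R B : List (ℕ × ℕ)) (h : History) : Prop :=
  (∀ p ∈ R, Rd h (f p.1) (f p.2)) ∧ ∀ p ∈ B, Bl h (f p.1) (f p.2)

theorem Facts.mono {f : ℕ → ℕ} {R B : List (ℕ × ℕ)} {h h' : History} (hh : h ⊆ h')
    (H : Facts f R B h) : Facts f R B h' :=
  ⟨fun p hp => hh (H.1 p hp), fun p hp => hh (H.2 p hp)⟩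

theorem adj_spec {R : List (ℕ × ℕ)} {x y : ℕ} (H : adj R x y = true) :
    (x, y) ∈ R ∨ (y, x) ∈ R := by
  unfold adj at H
  rw [List.any_eq_true] at H
  obtain ⟨⟨u, v⟩, hm, he⟩ := H
  simp only [Bool.or_eq_true, Bool.and_eq_true, beq_iff_eq] at he
  rcases he with ⟨rfl, rfl⟩ | ⟨rfl, rfl⟩
  · exact Or.inl hm
  · exact Or.inr hm

theorem Facts.red {f : ℕ → ℕ} {R B : List (ℕ × ℕ)} {h : History} (H : Facts f R B h) {x y : ℕ}
    (hxy : adj R x y = true) : Rd h (f x) (f y) := by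
  rcases adj_spec hxy with h1 | h1
  · exact H.1 _ h1
  · exact (H.1 _ h1).symm

theorem Facts.blue {f : ℕ → ℕ} {R B : List (ℕ × ℕ)} {h : History} (H : Facts f R B h) {x y : ℕ}
    (hxy : adj B x y = true) : Bl h (f x) (f y) := by
  rcases adj_spec hxy with h1 | h1
  · exact H.2 _ h1
  · exact (H.2 _ h1).symm

theorem win_of_isForced {n e : ℕ} {f : ℕ → ℕ} (hf : Function.Injective f) {R B : List (ℕ × ℕ)}
    {h : History} (HF : Facts f R B h) {x y : ℕ} (hxy : isForced R x y = true)
    (H : ∀ h' : History, h ⊆ h' → Bl h' (f x) (f y) → Win n e h') : Win n (e + 1) h := by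
  unfold isForced at hxy
  simp only [Bool.and_eq_true, bne_iff_ne, List.any_eq_true, Bool.or_eq_true] at hxy
  obtain ⟨hne, ⟨u, v⟩, hm, ⟨⟨⟨⟨hux, hvx⟩, huy⟩, hvy⟩, huv⟩, h1 | h1⟩ := hxy
  · exact Win.forced (hf.ne hux.symm) (hf.ne hvx.symm) (hf.ne hne) (hf.ne huv) (hf.ne huy)
      (hf.ne hvy) (HF.red h1.1) (HF.1 _ hm) (HF.red h1.2) H
  · exact Win.forced (hf.ne hvx.symm) (hf.ne hux.symm) (hf.ne hne) (hf.ne huv.symm) (hf.ne hvy)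
      (hf.ne huy) (HF.red h1.1) (HF.1 _ hm).symm (HF.red h1.2) H

theorem BP.cons {h : History} {l : List ℕ} {a x : ℕ} (H : BP h l) (ha : l.head? = some a)
    (hx : x ∉ l) (hax : Bl h a x) : BP h (x :: l) := by
  refine ⟨List.nodup_cons.2 ⟨hx, H.1⟩, ?_⟩
  cases l with
  | nil => simp
  | cons b l =>
    simp only [List.head?_cons, Option.some.injEq] at ha
    subst ha
    exact List.isChain_cons_cons.2 ⟨hax.symm, H.2⟩

theorem ext_sound {n s : ℕ} {f : ℕ → ℕ} (hf : Function.Injective f) {R B : List (ℕ × ℕ)} :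
    ∀ (xs : List ℕ) (a : ℕ) (vis : List ℕ) (e a' : ℕ) (vis' : List ℕ) (e' : ℕ) (h : History)
      (l : List ℕ), ext R B a vis e xs = some (a', vis', e') → Facts f R B h → BP h l →
      l.head? = some (f a) → (∀ i, i ∉ vis → f i ∉ l) →
      (∀ (h' : History) (l' : List ℕ), h ⊆ h' → BP h' l' → l'.head? = some (f a') →
        l'.getLast? = l.getLast? → l'.length = l.length + xs.length →
        (∀ i, i ∉ vis' → f i ∉ l') → Win n (e' + s) h') → Win n (e + s) h := by
  intro xs
  induction xs with
  | nil =>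
    intro a vis e a' vis' e' h l hext HF hl ha hvis H
    simp only [ext, Option.some.injEq, Prod.mk.injEq] at hext
    obtain ⟨rfl, rfl, rfl⟩ := hext
    exact H h l (List.Subset.refl h) hl ha rfl rfl hvis
  | cons x xs ih =>
    intro a vis e a' vis' e' h l hext HF hl ha hvis H
    have hne : l ≠ [] := by rintro rfl; simp at ha
    -- one step, when the new edge is blue
    have step : ∀ (e1 : ℕ) (h1 : History), h ⊆ h1 → x ∉ vis → Bl h1 (f a) (f x) →
        ext R B x (x :: vis) e1 xs = some (a', vis', e') → Win n (e1 + s) h1 := by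
      intro e1 h1 hh hx hb hext1
      refine ih x (x :: vis) e1 a' vis' e' h1 (f x :: l) hext1 (HF.mono hh)
        ((hl.mono hh).cons ha (hvis x hx) hb) rfl ?_ ?_
      · intro i hi
        simp only [List.mem_cons, not_or] at hi ⊢
        exact ⟨hf.ne hi.1, hvis i hi.2⟩
      · intro h' l' hh' hl' ha' hlast hlen hv'
        refine H h' l' (fun _ hz => hh' (hh hz)) hl' ha' ?_ ?_ hv'
        · rw [hlast]
          cases l with
          | nil => exact absurd rfl hne
          | cons b l => simp
        · simp only [List.length_cons] at hlen ⊢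
          omega
    unfold ext at hext
    split_ifs at hext with h1 h2 h3
    · have hx : x ∉ vis := by simpa using h1
      exact step e h (List.Subset.refl h) hx (HF.blue h2) hext
    · have hx : x ∉ vis := by simpa using h1
      cases e with
      | zero => simp at hext
      | succ e =>
        have : e + 1 + s = (e + s) + 1 := by omega
        rw [this]
        refine win_of_isForced hf HF h3 fun h' hh hb => ?_
        exact step e h' hh hx hb hext

/-- The position of the path before lengthening. -/
def Start (n r : ℕ) (st : Option (List ℕ)) (f : ℕ → ℕ) (h : History) : Prop :=
  ∀ xs a b vis xs', ends st xs = some (a, b, vis, xs') →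
    ∃ l, BP h l ∧ l.head? = some (f a) ∧ l.getLast? = some (f b) ∧ l.length + r = n ∧
      ∀ i, i ∉ vis → f i ∉ l

theorem Start.mono {n r : ℕ} {st : Option (List ℕ)} {f : ℕ → ℕ} {h h' : History} (hh : h ⊆ h')
    (H : Start n r st f h) : Start n r st f h' := by
  intro xs a b vis xs' he
  obtain ⟨l, h1, h2⟩ := H xs a b vis xs' he
  exact ⟨l, h1.mono hh, h2⟩

theorem ext2_sound {n r s : ℕ} {f : ℕ → ℕ} (hf : Function.Injective f) {st : Option (List ℕ)}
    {R B : List (ℕ × ℕ)} {xs ys : List ℕ} {e a b : ℕ} {vis : List ℕ} {e' k : ℕ} {h : History}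
    (hext : ext2 st R B e xs ys = some (a, b, vis, e', k)) (HF : Facts f R B h)
    (hst : Start n r st f h)
    (H : ∀ (h' : History) (l' : List ℕ), h ⊆ h' → BP h' l' → l'.head? = some (f a) →
        l'.getLast? = some (f b) → l'.length + r = n + k →
        (∀ i, i ∉ vis → f i ∉ l') → Win n (e' + s) h') : Win n (e + s) h := by
  unfold ext2 at hext
  split at hext
  · simp at hext
  · rename_i a0 b0 vis0 xs' hends
    obtain ⟨l, hl, ha, hb, hlen, hv⟩ := hst _ _ _ _ _ hends
    split at hext
    · simp at hext
    · rename_i a1 vis1 e1 hext1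
      split at hext
      · simp at hext
      · rename_i b2 vis2 e2 hext2
        simp only [Option.some.injEq, Prod.mk.injEq] at hext
        obtain ⟨rfl, rfl, rfl, rfl, rfl⟩ := hext
        refine ext_sound hf xs' a0 vis0 e _ vis1 e1 h l hext1 HF hl ha hv ?_
        intro h1 l1 hh1 hl1 ha1 hlast1 hlen1 hv1
        refine ext_sound hf ys b0 vis1 e1 _ _ _ h1 l1.reverse hext2 (HF.mono hh1) hl1.reverse
          ?_ ?_ ?_
        · rw [List.head?_reverse, hlast1, hb]
        · intro i hi
          rw [List.mem_reverse]
          exact hv1 i hi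
        · intro h2 l2 hh2 hl2 ha2 hlast2 hlen2 hv2
          refine H h2 l2.reverse (fun _ hz => hh2 (hh1 hz)) hl2.reverse ?_ ?_ ?_ ?_
          · rw [List.head?_reverse, hlast2, List.getLast?_reverse, ha1]
          · rw [List.getLast?_reverse, ha2]
          · simp only [List.length_reverse] at hlen2 ⊢
            omega
          · intro i hi
            rw [List.mem_reverse]
            exact hv2 i hi

/-- Builder wins from every position containing pattern `q`, with `r` vertices missing. -/
def Claim (n q r : ℕ) : Prop :=
  ∀ (h : History) (e : ℕ) (l : List ℕ) (F : ℕ → ℕ), BP h l → l.length + r = n →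
    (∀ i < (pat q).sz, ∀ j < (pat q).sz, F i = F j → i = j) →
    l.head? = some (F 0) → l.getLast? = some (F 1) →
    (∀ i < (pat q).sz, 2 ≤ i → i ∉ (pat q).inn → F i ∉ l) →
    (∀ p ∈ (pat q).red, Rd h (F p.1) (F p.2)) → 2 * r + (pat q).cc ≤ e + 2 → Win n e h

theorem matchPat_sound {n q' r : ℕ} {f : ℕ → ℕ} (hf : Function.Injective f)
    {R B : List (ℕ × ℕ)} {a b : ℕ} {vis g : List ℕ} {h : History} {l : List ℕ} {e : ℕ}
    (hm : matchPat q' R vis (a :: b :: g) = true) (HC : Claim n q' r) (HF : Facts f R B h)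
    (hl : BP h l) (ha : l.head? = some (f a)) (hb : l.getLast? = some (f b))
    (hlen : l.length + r = n) (hv : ∀ i, i ∉ vis → f i ∉ l)
    (he : 2 * r + (pat q').cc ≤ e + 2) : Win n e h := by
  unfold matchPat at hm
  simp only [Bool.and_eq_true, beq_iff_eq, decide_eq_true_eq] at hm
  obtain ⟨⟨⟨hsz, hnd⟩, hout⟩, hred⟩ := hm
  rw [List.all_eq_true] at hout hred
  refine HC h e l (fun i => f ((a :: b :: g).getD i 0)) hl hlen ?_ ha hb ?_ ?_ he
  · intro i hi j hj hij
    have := hf hij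
    rw [← hsz] at hi hj
    rw [List.getD_eq_getElem _ _ hi, List.getD_eq_getElem _ _ hj] at this
    exact hnd.getElem_inj_iff.1 this
  · intro i hi h2 hinn
    have := hout i (List.mem_range.2 hi)
    simp only [Bool.or_eq_true, decide_eq_true_eq, Bool.not_eq_true', List.elem_eq_mem,
      decide_eq_false_iff_not] at this
    rcases this with (h3 | h3) | h3
    · omega
    · exact absurd h3 hinn
    · exact hv _ h3
  · intro p hp
    exact HF.red (hred p hp)

theorem chk_sound {n q r s : ℕ} {sym : Bool} {st : Option (List ℕ)} {f : ℕ → ℕ}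
    (hf : Function.Injective f) (hs : sym = false → s = 0)
    (IH : ∀ q' r', q' < pats.length → (pat q').rmin ≤ r' →
      (r' < r + s ∨ r' = r + s ∧ q' < q) → Claim n q' r') :
    ∀ (t : Tree) (R B : List (ℕ × ℕ)) (e : ℕ) (h : History),
      chk st q r sym t R B e = true → Start n (r + s) st f h → Facts f R B h →
      Win n (e + 2 * s) h := by
  intro t
  induction t with
  | p i j t₁ t₂ ih₁ ih₂ =>
    intro R B e h hchk hst HF
    cases e with
    | zero => simp [chk] at hchk
    | succ e =>
      simp only [chk, Bool.and_eq_true, bne_iff_ne] at hchk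
      obtain ⟨⟨hij, h1⟩, h2⟩ := hchk
      have : e + 1 + 2 * s = (e + 2 * s) + 1 := by omega
      rw [this]
      refine Win.play (hf.ne hij) fun h' hh c hc => ?_
      have HF' := HF.mono hh
      cases c
      · refine ih₂ _ _ e h' h2 (hst.mono hh) ⟨HF'.1, ?_⟩
        intro p hp
        rcases List.mem_cons.1 hp with rfl | hp
        · exact hc
        · exact HF'.2 p hp
      · refine ih₁ _ _ e h' h1 (hst.mono hh) ⟨?_, HF'.2⟩
        intro p hp
        rcases List.mem_cons.1 hp with rfl | hp
        · exact hc
        · exact HF'.1 p hp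
  | l q' sw xs ys g =>
    intro R B e h hchk hst HF
    unfold chk at hchk
    split at hchk
    · simp at hchk
    · rename_i a b vis e' k hext
      simp only [Bool.and_eq_true, Bool.or_eq_true, decide_eq_true_eq] at hchk
      obtain ⟨⟨⟨⟨hq, hr⟩, he⟩, hlt⟩, hm⟩ := hchk
      refine ext2_sound hf hext HF hst ?_
      intro h' l' hh hl ha hb hlen hv
      have HC : Claim n q' (r + s - k) := IH q' _ hq (by omega) (by omega)
      cases sw
      · exact matchPat_sound hf hm HC (HF.mono hh) hl ha hb (by omega) hv (by omega)
      · refine matchPat_sound hf hm HC (HF.mono hh) hl.reverse ?_ ?_ ?_ ?_ (by omega)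
        · rw [List.head?_reverse, hb]
        · rw [List.getLast?_reverse, ha]
        · rw [List.length_reverse]; omega
        · intro i hi
          rw [List.mem_reverse]
          exact hv i hi
  | d xs ys =>
    intro R B e h hchk hst HF
    unfold chk at hchk
    split at hchk
    · simp at hchk
    · rename_i a b vis e' k hext
      simp only [Bool.and_eq_true, Bool.not_eq_true', decide_eq_true_eq] at hchk
      have hs0 := hs hchk.1
      refine ext2_sound hf hext HF hst ?_
      intro h' l' hh hl ha hb hlen hv
      exact Win.of_won (won_of_path hl (by omega)) _

theorem chkBase_spec {q : ℕ} : ∀ (ts : List Tree) (r0 r : ℕ), chkBase q r0 ts = true → r0 ≤ r →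
    r < r0 + ts.length →
    ∃ t, chk (some (pat q).inn) q r false t (pat q).red [] (2 * r + (pat q).cc - 2) = true := by
  intro ts
  induction ts with
  | nil =>
    intro r0 r _ h1 h2
    simp only [List.length_nil] at h2
    omega
  | cons t ts ih =>
    intro r0 r hc h1 h2
    simp only [chkBase, Bool.and_eq_true] at hc
    simp only [List.length_cons] at h2
    by_cases hr : r = r0
    · subst hr
      exact ⟨t, hc.1⟩
    · exact ih (r0 + 1) r hc.2 (by omega) (by omega)

theorem chkAll_spec : ∀ (k q : ℕ), chkAll k = true → q < k → chkPat q = true := by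
  intro k
  induction k with
  | zero => intro q _ h; omega
  | succ k ih =>
    intro q hk hq
    simp only [chkAll, Bool.and_eq_true] at hk
    by_cases h : q = k
    · subst h; exact hk.1
    · exact ih q hk.2 (by omega)

/-- Extend a naming of finitely many vertices to all names, using vertices outside of `l`. -/
theorem exists_naming (F : ℕ → ℕ) (sz : ℕ) (l : List ℕ)
    (hF : ∀ i < sz, ∀ j < sz, F i = F j → i = j) :
    ∃ f : ℕ → ℕ, Function.Injective f ∧ (∀ i < sz, f i = F i) ∧ ∀ i, sz ≤ i → f i ∉ l := by
  obtain ⟨M, hM1, hM2⟩ : ∃ M, (∀ x ∈ l, x < M) ∧ ∀ i < sz, F i < M := by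
    refine ⟨l.sum + (∑ i ∈ Finset.range sz, F i) + 1, fun x hx => ?_, fun i hi => ?_⟩
    · have := List.single_le_sum (fun _ _ => Nat.zero_le _) x hx
      omega
    · have := Finset.single_le_sum (f := F) (fun _ _ => Nat.zero_le _) (Finset.mem_range.2 hi)
      omega
  refine ⟨fun i => if i < sz then F i else M + i, ?_, fun i hi => if_pos hi, fun i hi hc => ?_⟩
  · intro i j hij
    simp only at hij
    split_ifs at hij with h1 h2 h2
    · exact hF i h1 j h2 hij
    · have := hM2 i h1; omega
    · have := hM2 j h2; omega
    · omega
  · have hc := hM1 _ hc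
    simp only [if_neg (not_lt.2 hi)] at hc
    omega

theorem claim_step {n q r : ℕ} (hq : q < pats.length) (hr : (pat q).rmin ≤ r)
    (IH : ∀ q' r', q' < pats.length → (pat q').rmin ≤ r' →
      (r' < r ∨ r' = r ∧ q' < q) → Claim n q' r') : Claim n q r := by
  have hc := chkAll_spec 23 q chkAll_ok hq
  unfold chkPat at hc
  simp only [Bool.and_eq_true, decide_eq_true_eq, List.all_eq_true] at hc
  obtain ⟨⟨⟨⟨hr1, hsz⟩, hred⟩, hbase⟩, hsym⟩ := hc
  intro h e l F hl hlen hF ha hb hout hredF he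
  obtain ⟨f, hf, hfF, hfl⟩ := exists_naming F (pat q).sz l hF
  have hst : Start n r (some (pat q).inn) f h := by
    intro xs a b vis xs' hends
    simp only [ends, Option.some.injEq, Prod.mk.injEq] at hends
    obtain ⟨rfl, rfl, rfl, rfl⟩ := hends
    refine ⟨l, hl, ?_, ?_, hlen, ?_⟩
    · rw [hfF 0 (by omega), ha]
    · rw [hfF 1 (by omega), hb]
    · intro i hi
      simp only [List.mem_cons, not_or] at hi
      by_cases his : i < (pat q).sz
      · rw [hfF i his]
        exact hout i his (by omega) hi.2.2
      · exact hfl i (by omega)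
  have hfacts : Facts f (pat q).red [] h := by
    refine ⟨fun p hp => ?_, fun p hp => by simp at hp⟩
    rw [hfF _ (hred p hp).1, hfF _ (hred p hp).2]
    exact hredF p hp
  by_cases hrb : r < (pat q).rmin + (pat q).base.length
  · obtain ⟨t, ht⟩ := chkBase_spec _ _ r hbase hr hrb
    have := chk_sound (s := 0) (n := n) hf (fun _ => rfl) IH t _ _ _ h ht hst hfacts
    exact this.mono (by omega)
  · obtain ⟨s, rfl⟩ : ∃ s, r = (pat q).rmin + (pat q).base.length + s :=
      ⟨r - ((pat q).rmin + (pat q).base.length), by omega⟩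
    have := chk_sound (s := s) (n := n) hf (fun h => by simp at h) IH _ _ _ _ h hsym hst hfacts
    exact this.mono (by omega)

theorem claim_all (n : ℕ) : ∀ r q, q < pats.length → (pat q).rmin ≤ r → Claim n q r := by
  intro r
  induction r using Nat.strong_induction_on with
  | _ r ihr =>
    intro q
    induction q using Nat.strong_induction_on with
    | _ q ihq =>
      intro hq hr
      refine claim_step hq hr fun q' r' hq' hr' hlt => ?_
      rcases hlt with hlt | ⟨rfl, hlt⟩
      · exact ihr r' hlt q' hq' hr'
      · exact ihq q' hlt hq' hr'

theorem main_forces (n : ℕ) (hn : 8 ≤ n) :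
    BuilderForces (SimpleGraph.cycleGraph 4) (SimpleGraph.pathGraph n) (2 * n - 2) := by
  apply forces_of_win
  obtain ⟨s, rfl⟩ : ∃ s, n = 8 + s := ⟨n - 8, by omega⟩
  have hst : Start (8 + s) (7 + s) none id [] := by
    intro xs a b vis xs' hends
    cases xs with
    | nil => simp [ends] at hends
    | cons v xs =>
      simp only [ends, Option.some.injEq, Prod.mk.injEq] at hends
      obtain ⟨rfl, rfl, rfl, rfl⟩ := hends
      refine ⟨[v], ⟨by simp, by simp⟩, rfl, rfl, ?_, ?_⟩
      · simp only [List.length_singleton]; omega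
      · intro i hi
        simpa using hi
  have := chk_sound (s := s) (n := 8 + s) Function.injective_id (fun h => by simp at h)
    (fun q' r' hq hr _ => claim_all (8 + s) r' q' hq hr) treeStart [] [] 14 [] chkStart_ok hst
    ⟨fun p hp => by simp at hp, fun p hp => by simp at hp⟩
  exact this.mono (by omega)

/-- For every `n ≥ 8`, `r̃(C₄, Pₙ) ≤ 2n - 2`. -/
theorem onlineRamsey_C4_path_upper (n : ℕ) (hn : 8 ≤ n) :
    BuilderForces (SimpleGraph.cycleGraph 4) (SimpleGraph.pathGraph n) (2 * n - 2) := by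
  exact main_forces n hn

end OnlineRamsey
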